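/- arXiv:1108.5641 — 2 statements merged into one kernel-verified Lean document; each statement's English description precedes it below -/
import Mathlib

section
/- Let F be a free group of rank 2 and A any nontrivial subgroup of F. Then acl(A) = dcl(A). -/
open FirstOrder Filter

/-! Common definitions: the first-order language of groups, algebraic/definable closures,
free products, amalgams, HNN extensions, etc. -/

/-- Function symbols of the language of groups: `1`, `⁻¹`, `·`. -/
inductive GrpFunc : ℕ → Type
  | one : GrpFunc 0
  | inv : GrpFunc 1
  | mul : GrpFunc 2

/-- The first-order language of groups `L = {·, ⁻¹, 1}` (no relation symbols). -/
def grpLang : FirstOrder.Language := ⟨GrpFunc, fun _ => Empty⟩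

/-- Every group is a `grpLang`-structure in the natural way. -/
instance grpStructure (G : Type*) [Group G] : grpLang.Structure G where
  funMap {_} f := match f with
    | .one => fun _ => (1 : G)
    | .inv => fun x => (x 0)⁻¹
    | .mul => fun x => x 0 * x 1
  RelMap {_} r := Empty.elim r

/-- A formula is existential if it is obtained from a quantifier-free formula by
prefixing existential quantifiers. -/
def IsExistential {L : FirstOrder.Language} {α : Type*} (φ : L.Formula α) : Prop :=
  ∃ (n : ℕ) (ψ : L.BoundedFormula α n), ψ.IsQF ∧ φ = ψ.exs

section ModelTheory

variable (L : FirstOrder.Language) {M : Type*} [L.Structure M]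

/-- The algebraic closure of a set of parameters `A` in an `L`-structure `M`:
elements satisfying, together with only finitely many other elements, some formula
with parameters from `A`. -/
def Lacl (A : Set M) : Set M :=
  {b | ∃ φ : L.Formula (↥A ⊕ Fin 1),
    {c : M | φ.Realize (Sum.elim Subtype.val fun _ => c)}.Finite ∧
    φ.Realize (Sum.elim Subtype.val fun _ => b)}

/-- The definable closure of a set of parameters `A` in an `L`-structure `M`. -/
def Ldcl (A : Set M) : Set M :=
  {b | ∃ φ : L.Formula (↥A ⊕ Fin 1),
    {c : M | φ.Realize (Sum.elim Subtype.val fun _ => c)} = {b}}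

/-- The existential algebraic closure of `A` in `M`. -/
def LaclE (A : Set M) : Set M :=
  {b | ∃ φ : L.Formula (↥A ⊕ Fin 1), IsExistential φ ∧
    {c : M | φ.Realize (Sum.elim Subtype.val fun _ => c)}.Finite ∧
    φ.Realize (Sum.elim Subtype.val fun _ => b)}

/-- The existential definable closure of `A` in `M`. -/
def LdclE (A : Set M) : Set M :=
  {b | ∃ φ : L.Formula (↥A ⊕ Fin 1), IsExistential φ ∧
    {c : M | φ.Realize (Sum.elim Subtype.val fun _ => c)} = {b}}

end ModelTheory

section GroupDefs

variable {G : Type*} [Group G]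

/-- Algebraic closure in a group, w.r.t. the language of groups. -/
def acl (A : Set G) : Set G := Lacl grpLang A

/-- Definable closure in a group, w.r.t. the language of groups. -/
def dcl (A : Set G) : Set G := Ldcl grpLang A

/-- Existential algebraic closure in a group. -/
def aclE (A : Set G) : Set G := LaclE grpLang A

/-- Existential definable closure in a group. -/
def dclE (A : Set G) : Set G := LdclE grpLang A

/-- Restricted algebraic closure: elements with finite orbit under automorphisms
of `G` fixing `A` pointwise. -/
def racl (A : Set G) : Set G :=
  {g | {x : G | ∃ f : G ≃* G, (∀ a ∈ A, f a = a) ∧ f g = x}.Finite}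

/-- Restricted definable closure: elements fixed by every automorphism of `G`
fixing `A` pointwise. -/
def rdcl (A : Set G) : Set G :=
  {g | ∀ f : G ≃* G, (∀ a ∈ A, f a = a) → f g = g}

/-- A set of group elements is nonabelian (contains two non-commuting elements). -/
def Nonabelian (A : Set G) : Prop := ∃ x ∈ A, ∃ y ∈ A, x * y ≠ y * x

/-- `F` is a free group of finite rank. -/
def IsFreeOfFiniteRank (F : Type*) [Group F] : Prop :=
  ∃ n : ℕ, Nonempty (F ≃* FreeGroup (Fin n))

/-- `G` is the internal free product of its subgroups `H` and `K`: the canonical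
homomorphism from the abstract free product `H ∗ K` to `G` is an isomorphism. -/
def InternalFreeProduct (H K : Subgroup G) : Prop :=
  Function.Bijective (Monoid.Coprod.lift H.subtype K.subtype)

/-- `G` is freely indecomposable relative to its subgroup `A`. -/
def FreelyIndecomposableRel (A : Subgroup G) : Prop :=
  ¬ ∃ G₁ G₂ : Subgroup G, G₁ ≠ ⊥ ∧ G₂ ≠ ⊥ ∧ A ≤ G₁ ∧ InternalFreeProduct G₁ G₂

/-- `B` is a free factor of the subgroup `K`: there is `L` such that the canonical
homomorphism from the abstract free product `B ∗ L` to the ambient group is injective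
with image exactly `K`. -/
def IsFreeFactorOf (B K : Subgroup G) : Prop :=
  ∃ L : Subgroup G,
    Function.Injective (Monoid.Coprod.lift B.subtype L.subtype) ∧
    (Monoid.Coprod.lift B.subtype L.subtype).range = K

/-- `K'` is the amalgamated free product `K ∗_C B` inside the ambient group `G`:
the canonical homomorphism from the abstract amalgamated product (pushout) of `K` and
`B` over `C` to `G` is injective with image exactly `K'`. -/
def IsAmalgamOf (K B C : Subgroup G) (hCK : C ≤ K) (hCB : C ≤ B) (K' : Subgroup G) : Prop :=
  ∃ ℓ : Monoid.PushoutI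
      (fun i : Bool =>
        (Subgroup.inclusion (show C ≤ cond i K B by cases i <;> assumption) :
          ↥C →* ↥(cond i K B))) →* G,
    (∀ i : Bool, ℓ.comp (Monoid.PushoutI.of i) = (cond i K B).subtype) ∧
    Function.Injective ℓ ∧ ℓ.range = K'

/-- `K'` is the HNN extension of `K` along `φ : C ≃* D` inside the ambient group `G`:
the canonical homomorphism from the abstract HNN extension of `K` along `φ` to `G` is
injective with image exactly `K'` (and is the inclusion on `K`). -/
def IsHNNOf (K : Subgroup G) {C D : Subgroup ↥K} (φ : ↥C ≃* ↥D) (K' : Subgroup G) : Prop :=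
  ∃ ℓ : HNNExtension ↥K C D φ →* G,
    ℓ.comp HNNExtension.of = K.subtype ∧ Function.Injective ℓ ∧ ℓ.range = K'

/-- One constructibility step: `K'` is an amalgamated free product of `K` with some
subgroup over a cyclic subgroup, or an HNN extension of `K` along an isomorphism of two
cyclic subgroups of `K`. -/
def ConstructStep (K K' : Subgroup G) : Prop :=
  (∃ (B C : Subgroup G) (hCK : C ≤ K) (hCB : C ≤ B),
      (∃ c : G, C = Subgroup.zpowers c) ∧ B ≤ K' ∧ K ≤ K' ∧ IsAmalgamOf K B C hCK hCB K')
  ∨ (∃ (C D : Subgroup ↥K) (φ : ↥C ≃* ↥D),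
      (∃ c : ↥K, C = Subgroup.zpowers c) ∧ (∃ d : ↥K, D = Subgroup.zpowers d) ∧ IsHNNOf K φ K')

/-- `B` is constructible from `A` by a finite sequence of amalgamated free products and
HNN-extensions along cyclic subgroups. -/
def ConstructibleFrom (A B : Subgroup G) : Prop := Relation.ReflTransGen ConstructStep A B

/-- The rank of a subgroup: the least cardinality of a generating set. For (subgroups of)
free groups this is the cardinality of a basis. -/
noncomputable def srank (H : Subgroup G) : Cardinal :=
  sInf {c : Cardinal | ∃ S : Set G, Subgroup.closure S = H ∧ c = Cardinal.mk ↥S}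

/-- `M` is a maximal abelian subgroup. -/
def IsMaxAbelian (M : Subgroup G) : Prop :=
  (∀ x ∈ M, ∀ y ∈ M, x * y = y * x) ∧
  ∀ N : Subgroup G, (∀ x ∈ N, ∀ y ∈ N, x * y = y * x) → M ≤ N → M = N

/-- `M` is a maximal abelian subgroup of the subgroup `H`. -/
def IsMaxAbelianIn (M H : Subgroup G) : Prop :=
  M ≤ H ∧ (∀ x ∈ M, ∀ y ∈ M, x * y = y * x) ∧
  ∀ N : Subgroup G, N ≤ H → (∀ x ∈ N, ∀ y ∈ N, x * y = y * x) → M ≤ N → M = N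

/-- `M` is a malnormal subgroup: `gMg⁻¹ ∩ M = 1` for every `g ∉ M`. -/
def Malnormal (M : Subgroup G) : Prop :=
  ∀ g : G, g ∉ M → ∀ x ∈ M, g * x * g⁻¹ ∈ M → x = 1

/-- A group is CSA if every maximal abelian subgroup is malnormal. -/
def IsCSA (G : Type*) [Group G] : Prop := ∀ M : Subgroup G, IsMaxAbelian M → Malnormal M

/-- Every abelian subgroup of `G` is cyclic. -/
def AbelianSubgroupsCyclic (G : Type*) [Group G] : Prop :=
  ∀ H : Subgroup G, (∀ x ∈ H, ∀ y ∈ H, x * y = y * x) → ∃ g : G, H = Subgroup.zpowers g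

/-- `G` is equationally noetherian: every system of equations over `G` in finitely many
variables is equivalent to a finite subsystem. -/
def EqNoetherian (G : Type*) [Group G] : Prop :=
  ∀ n : ℕ, 0 < n → ∀ S : Set (Monoid.Coprod G (FreeGroup (Fin n))),
    ∃ S₀ : Set (Monoid.Coprod G (FreeGroup (Fin n))), S₀ ⊆ S ∧ S₀.Finite ∧
      ∀ f : Monoid.Coprod G (FreeGroup (Fin n)) →* G,
        f.comp Monoid.Coprod.inl = MonoidHom.id G →
        ((∀ s ∈ S₀, f s = 1) ↔ ∀ s ∈ S, f s = 1)

/-- A group homomorphism is elementary w.r.t. the language of groups: it preserves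
and reflects all first-order formulas. -/
def ElementaryEmb {H K : Type*} [Group H] [Group K] (e : H →* K) : Prop :=
  ∀ (n : ℕ) (φ : grpLang.Formula (Fin n)) (v : Fin n → H),
    (φ.Realize fun i => e (v i)) ↔ φ.Realize v

/-- The inclusion of the subgroup `H` is an elementary embedding; i.e. the ambient group
is an elementary extension of `H`. -/
def ElementarySub (H : Subgroup G) : Prop := ElementaryEmb H.subtype

/-- A sequence of homomorphisms is stable. -/
def StableSeq {K H : Type*} [Group K] [Group H] (h : ℕ → (K →* H)) : Prop :=
  ∀ k : K, (∀ᶠ n in Filter.atTop, h n k = 1) ∨ (∀ᶠ n in Filter.atTop, h n k ≠ 1)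

/-- A sequence of homomorphisms has trivial stable kernel. -/
def TrivialStableKernel {K H : Type*} [Group K] [Group H] (h : ℕ → (K →* H)) : Prop :=
  ∀ k : K, (∀ᶠ n in Filter.atTop, h n k = 1) → k = 1

/-- A stable sequence of homomorphisms `g n : D → H` with trivial stable kernel strongly
converges to `D`, where `D` is a subgroup of an extension of the base group `H`, the base
group being embedded via `e`. -/
def StronglyConverges {H Gs : Type*} [Group H] [Group Gs] (e : H →* Gs)
    (D : Subgroup Gs) (g : ℕ → (↥D →* H)) : Prop :=
  StableSeq g ∧ TrivialStableKernel g ∧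
  (∀ (d : ↥D) (b : H), (d : Gs) = e b → ∀ᶠ n in Filter.atTop, g n d = b) ∧
  (∀ (d : ↥D) (b : H), (∃ᶠ n in Filter.atTop, g n d = b) → (d : Gs) = e b)

/-- The ball of radius `r` about the identity in the word metric w.r.t. `S`. -/
def wordBall (S : Set G) (r : ℕ) : Set G :=
  {g | ∃ l : List G, l.length ≤ r ∧ (∀ x ∈ l, x ∈ S ∨ x⁻¹ ∈ S) ∧ l.prod = g}

end GroupDefs

namespace RankTwo

/-- Length of the longest common prefix of two lists. -/
def lcp {β : Type*} [DecidableEq β] : List β → List β → ℕ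
  | x :: xs, y :: ys => if x = y then lcp xs ys + 1 else 0
  | _, _ => 0

section Lcp
variable {β : Type*} [DecidableEq β]

@[simp] lemma lcp_nil_left (l : List β) : lcp [] l = 0 := by simp [lcp]
@[simp] lemma lcp_nil_right (l : List β) : lcp l [] = 0 := by cases l <;> simp [lcp]
lemma lcp_cons (x y : β) (xs ys : List β) :
    lcp (x :: xs) (y :: ys) = if x = y then lcp xs ys + 1 else 0 := by rw [lcp]

lemma lcp_comm (l l' : List β) : lcp l l' = lcp l' l := by
  induction l generalizing l' with
  | nil => simp
  | cons x xs ih =>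
    cases l' with
    | nil => simp
    | cons y ys => simp only [lcp_cons, ih ys, eq_comm]

lemma lcp_ultra (l₁ l₂ l₃ : List β) : min (lcp l₁ l₂) (lcp l₂ l₃) ≤ lcp l₁ l₃ := by
  induction l₂ generalizing l₁ l₃ with
  | nil => simp
  | cons y ys ih =>
    cases l₁ with
    | nil => simp
    | cons x xs =>
      cases l₃ with
      | nil => simp
      | cons z zs =>
        have := ih xs zs
        simp only [lcp_cons]
        split_ifs <;> simp_all

lemma lcp_le_left (l l' : List β) : lcp l l' ≤ l.length := by
  induction l generalizing l' with
  | nil => simp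
  | cons x xs ih =>
    cases l' with
    | nil => simp
    | cons y ys =>
      have := ih ys
      simp only [lcp_cons, List.length_cons]
      split_ifs <;> omega

lemma getElem_eq_of_lt_lcp {l l' : List β} {i : ℕ} (h : i < lcp l l') :
    l[i]? = l'[i]? := by
  induction l generalizing l' i with
  | nil => simp at h
  | cons x xs ih =>
    cases l' with
    | nil => simp at h
    | cons y ys =>
      rw [lcp_cons] at h
      split_ifs at h with hxy
      · cases i with
        | zero => simp [hxy]
        | succ i => simpa using ih (by omega)
      · omega

lemma lcp_pos_iff (l l' : List β) : 0 < lcp l l' ↔ l ≠ [] ∧ l.head? = l'.head? := by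
  cases l with
  | nil => simp
  | cons x xs =>
    cases l' with
    | nil => simp
    | cons y ys => by_cases h : x = y <;> simp [lcp_cons, h]

end Lcp

section Norm
variable {α : Type*} [DecidableEq α]
open FreeGroup

/-- Gromov product of two elements of a free group based at `1`. -/
def gp (g h : FreeGroup α) : ℕ := lcp g.toWord h.toWord

lemma gp_comm (g h : FreeGroup α) : gp g h = gp h g := lcp_comm _ _
lemma gp_ultra (g h k : FreeGroup α) : min (gp g h) (gp h k) ≤ gp g k := lcp_ultra _ _ _
lemma norm_mk_of_isReduced {l : List (α × Bool)} (h : IsReduced l) : (mk l).norm = l.length := by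
  rw [FreeGroup.norm, toWord_mk, h.reduce_eq]

lemma isReduced_invRev {l : List (α × Bool)} (h : IsReduced l) : IsReduced (invRev l) := by
  rw [isReduced_iff_reduce_eq, reduce_invRev, h.reduce_eq]

lemma norm_inv_mul_mk (l l' : List (α × Bool)) (h : IsReduced l) (h' : IsReduced l') :
    ((mk l)⁻¹ * mk l').norm + 2 * lcp l l' = l.length + l'.length := by
  induction l generalizing l' with
  | nil => simpa [← FreeGroup.one_eq_mk] using norm_mk_of_isReduced h'
  | cons x xs ih =>
    cases l' with
    | nil =>
      rw [← FreeGroup.one_eq_mk, mul_one, FreeGroup.norm_inv_eq, norm_mk_of_isReduced h]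
      simp
    | cons y ys =>
      rw [lcp_cons]
      split_ifs with hxy
      · subst hxy
        have e : (mk (x :: xs))⁻¹ * mk (x :: ys) = (mk xs)⁻¹ * mk ys := by
          have e1 (l : List (α × Bool)) : mk (x :: l) = mk [x] * mk l := by
            rw [mul_mk]; rfl
          rw [e1 xs, e1 ys]; group
        have hx : IsReduced xs := by
          unfold FreeGroup.IsReduced at *; exact h.tail
        have hy : IsReduced ys := by
          unfold FreeGroup.IsReduced at *; exact h'.tail
        have := ih ys hx hy
        rw [e]; simp only [List.length_cons]; omega
      · have : IsReduced (invRev (x :: xs) ++ (y :: ys)) := by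
          have h1 := isReduced_invRev h
          unfold FreeGroup.IsReduced at *
          rw [List.isChain_append]
          refine ⟨h1, h', ?_⟩
          intro p hp q hq
          simp [invRev] at hp hq
          subst hq; subst hp
          intro e
          rcases x with ⟨x, b⟩
          rcases y with ⟨y, b'⟩
          simp at e hxy ⊢
          have := hxy e
          cases b <;> cases b' <;> simp_all
        rw [inv_mk, mul_mk, norm_mk_of_isReduced this]
        simp [invRev_length]

lemma norm_inv_mul (g h : FreeGroup α) : (g⁻¹ * h).norm + 2 * gp g h = g.norm + h.norm := by
  have := norm_inv_mul_mk g.toWord h.toWord isReduced_toWord isReduced_toWord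
  rwa [mk_toWord, mk_toWord] at this

lemma norm_mul_add (g h : FreeGroup α) : (g * h).norm + 2 * gp g⁻¹ h = g.norm + h.norm := by
  have := norm_inv_mul g⁻¹ h
  simpa [FreeGroup.norm_inv_eq] using this

lemma norm_lt_norm_mul_self {g : FreeGroup α} (hg : g ≠ 1) : g.norm < (g * g).norm := by
  have h := norm_mul_add g g
  by_contra! hc
  have hr : IsReduced g.toWord := isReduced_toWord
  have hc2 : g.norm ≤ 2 * gp g⁻¹ g := by omega
  have hpos : 0 < g.norm := by
    rw [Nat.pos_iff_ne_zero]; simpa [FreeGroup.norm_eq_zero] using hg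
  rw [gp, toWord_inv] at hc2
  rw [FreeGroup.norm] at hc2 hpos
  generalize g.toWord = l at hr hc2 hpos
  set i := (l.length - 1) / 2 with hi
  have hk : i < lcp (invRev l) l := by omega
  have := getElem_eq_of_lt_lcp hk
  have hil : i < l.length := by omega
  have hil2 : l.length - 1 - i < l.length := by omega
  simp only [invRev, List.getElem?_reverse, List.length_map, hil, List.getElem?_map] at this
  rw [List.getElem?_eq_getElem hil2, List.getElem?_eq_getElem hil] at this
  simp only [Option.map_some, Option.some.injEq] at this
  unfold FreeGroup.IsReduced at hr
  rw [List.isChain_iff_getElem] at hr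
  rcases Nat.even_or_odd l.length with ⟨k, hk⟩ | ⟨k, hk⟩
  · have h2 := hr i (by omega)
    have e : l.length - 1 - i = i + 1 := by omega
    simp only [e] at this
    rw [← this] at h2
    simp at h2
  · have e : l.length - 1 - i = i := by omega
    simp only [e] at this
    have := congrArg Prod.snd this
    simp at this

end Norm

open FreeGroup hiding map_mul map_inv map_one map_pure map


/-- The free group on two generators. -/
abbrev F2 := FreeGroup (Fin 2)
/-- The first generator. -/
abbrev ga : F2 := FreeGroup.of 0
/-- The second generator. -/
abbrev gb : F2 := FreeGroup.of 1

/-- The homomorphism from the free group of rank two with prescribed images of the generators. -/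
def pairHom {G : Type*} [Group G] (u v : G) : F2 →* G := FreeGroup.lift ![u, v]

section PairHom
variable {G : Type*} [Group G]

@[simp] lemma pairHom_ga (u v : G) : pairHom u v ga = u := by simp [pairHom]
@[simp] lemma pairHom_gb (u v : G) : pairHom u v gb = v := by simp [pairHom]

lemma hom_ext_pair {f g : F2 →* G} (ha : f ga = g ga) (hb : f gb = g gb) : f = g := by
  ext i; fin_cases i
  · exact ha
  · exact hb

lemma eq_pairHom (f : F2 →* G) : f = pairHom (f ga) (f gb) := hom_ext_pair (by simp) (by simp)

end PairHom

/-- The letters of the alphabet: generators with a sign. -/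
abbrev Letter := Fin 2 × Bool

/-- The formal inverse of a letter. -/
def Letter.flip (x : Letter) : Letter := (x.1, !x.2)

/-- A letter as an element of the free group. -/
def el (x : Letter) : F2 := FreeGroup.mk [x]

lemma el_zero_true : el (0, true) = ga := rfl
lemma el_one_true : el (1, true) = gb := rfl
lemma el_flip (x : Letter) : el x.flip = (el x)⁻¹ := by simp [el, Letter.flip, inv_mk, invRev]
lemma el_zero_false : el (0, false) = ga⁻¹ := el_flip (0, true)
lemma el_one_false : el (1, false) = gb⁻¹ := el_flip (1, true)
lemma mk_cons (x : Letter) (l : List Letter) : (mk (x :: l) : F2) = el x * mk l := by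
  rw [el, mul_mk]; rfl

lemma Letter.eq_or_eq_flip {x y : Letter} (h : x.1 = y.1) : x = y ∨ x = y.flip := by
  revert x y; decide

lemma finite_ball (N : ℕ) : {w : F2 | w.norm ≤ N}.Finite := by
  have : {w : F2 | w.norm ≤ N} ⊆
      (fun l : List Letter => (FreeGroup.mk l : F2)) '' {l : List Letter | l.length ≤ N} := by
    intro w hw
    exact ⟨w.toWord, hw, mk_toWord⟩
  exact ((List.finite_length_le Letter N).image _).subset this

lemma Letter.fst_eq_of_ne {x y z : Letter} (h : x.1 ≠ y.1) (h' : y.1 ≠ z.1) : x.1 = z.1 := by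
  omega

/-- Elementary Nielsen transformations: swap of generators. -/
def nSwap : Monoid.End F2 := pairHom gb ga
/-- Inversion of the second generator. -/
def nInv : Monoid.End F2 := pairHom ga gb⁻¹
/-- Multiplication of the first generator by the second one. -/
def nTwist : Monoid.End F2 := pairHom (gb * ga) gb

/-- The endomorphism with prescribed images of the generators. -/
def pairEnd (u v : F2) : Monoid.End F2 := pairHom u v

@[simp] lemma pairEnd_ga (u v : F2) : pairEnd u v ga = u := pairHom_ga u v
@[simp] lemma pairEnd_gb (u v : F2) : pairEnd u v gb = v := pairHom_gb u v

/-- The monoid generated by the elementary Nielsen transformations. -/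
def nielsen : Submonoid (Monoid.End F2) := Submonoid.closure {nSwap, nInv, nTwist}

lemma end_ext_pair {f g : Monoid.End F2} (ha : f ga = g ga) (hb : f gb = g gb) : f = g :=
  hom_ext_pair ha hb

@[simp] lemma nSwap_ga : nSwap ga = gb := pairHom_ga _ _
@[simp] lemma nSwap_gb : nSwap gb = ga := pairHom_gb _ _
@[simp] lemma nInv_ga : nInv ga = ga := pairHom_ga _ _
@[simp] lemma nInv_gb : nInv gb = gb⁻¹ := pairHom_gb _ _
@[simp] lemma nTwist_ga : nTwist ga = gb * ga := pairHom_ga _ _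
@[simp] lemma nTwist_gb : nTwist gb = gb := pairHom_gb _ _

lemma nSwap_mem : nSwap ∈ nielsen := Submonoid.subset_closure (by simp)
lemma nInv_mem : nInv ∈ nielsen := Submonoid.subset_closure (by simp)
lemma nTwist_mem : nTwist ∈ nielsen := Submonoid.subset_closure (by simp)

lemma end_mul_apply (f g : Monoid.End F2) (x : F2) : (f * g) x = f (g x) := rfl
lemma end_one_apply (x : F2) : (1 : Monoid.End F2) x = x := rfl

lemma exists_nielsen_inv {f : Monoid.End F2} (hf : f ∈ nielsen) :
    ∃ g ∈ nielsen, f * g = 1 ∧ g * f = 1 := by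
  induction hf using Submonoid.closure_induction with
  | mem x hx =>
    rcases hx with rfl | rfl | rfl
    · have : nSwap * nSwap = 1 := end_ext_pair (by simp [end_mul_apply, end_one_apply])
        (by simp [end_mul_apply, end_one_apply])
      exact ⟨_, nSwap_mem, this, this⟩
    · have : nInv * nInv = 1 := end_ext_pair (by simp [end_mul_apply, end_one_apply])
        (by simp [end_mul_apply, end_one_apply])
      exact ⟨_, nInv_mem, this, this⟩
    · exact ⟨nInv * nTwist * nInv, mul_mem (mul_mem nInv_mem nTwist_mem) nInv_mem,
        end_ext_pair (by simp [end_mul_apply, end_one_apply])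
          (by simp [end_mul_apply, end_one_apply]),
        end_ext_pair (by simp [end_mul_apply, end_one_apply])
          (by simp [end_mul_apply, end_one_apply])⟩
  | one => exact ⟨1, one_mem _, by simp, by simp⟩
  | mul x y _ _ hx hy =>
    obtain ⟨x', hx', h1, h2⟩ := hx
    obtain ⟨y', hy', h3, h4⟩ := hy
    refine ⟨y' * x', mul_mem hy' hx', ?_, ?_⟩
    · rw [mul_assoc, ← mul_assoc y, h3, one_mul, h1]
    · rw [mul_assoc, ← mul_assoc x', h2, one_mul, h4]

lemma bijective_of_mem_nielsen {f : Monoid.End F2} (hf : f ∈ nielsen) : Function.Bijective f := by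
  obtain ⟨g, -, h1, h2⟩ := exists_nielsen_inv hf
  refine Function.bijective_iff_has_inverse.2 ⟨g, fun x => ?_, fun x => ?_⟩
  · rw [← end_mul_apply, h2]; rfl
  · rw [← end_mul_apply, h1]; rfl

lemma mem_nielsen_of_mul_mem {f g : Monoid.End F2} (hg : g ∈ nielsen) (h : f * g ∈ nielsen) :
    f ∈ nielsen := by
  obtain ⟨g', hg', h1, -⟩ := exists_nielsen_inv hg
  have := mul_mem h hg'
  rwa [mul_assoc, h1, mul_one] at this

lemma signedPerm_mem {x y : Letter} (h : x.1 ≠ y.1) :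
    (pairEnd (el x) (el y)) ∈ nielsen := by
  have hA : (pairEnd ga⁻¹ gb) ∈ nielsen := by
    have : (pairEnd ga⁻¹ gb) = nSwap * nInv * nSwap :=
      end_ext_pair (by simp [end_mul_apply]) (by simp [end_mul_apply])
    rw [this]; exact mul_mem (mul_mem nSwap_mem nInv_mem) nSwap_mem
  have h1 : ∀ x : Letter, x.1 = 0 → ∀ y : Letter, y.1 = 1 →
      (pairEnd (el x) (el y)) ∈ nielsen := by
    rintro ⟨x, b⟩ rfl ⟨y, b'⟩ rfl
    cases b <;> cases b' <;>
      simp only [el_zero_true, el_zero_false, el_one_true, el_one_false]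
    · have : (pairEnd ga⁻¹ gb⁻¹) = pairEnd ga⁻¹ gb * nInv :=
        end_ext_pair (by simp [end_mul_apply]) (by simp [end_mul_apply])
      rw [this]; exact mul_mem hA nInv_mem
    · exact hA
    · exact nInv_mem
    · rw [show (pairEnd ga gb) = 1 from
        end_ext_pair (by simp [end_one_apply]) (by simp [end_one_apply])]
      exact one_mem _
  by_cases hx : x.1 = 0
  · exact h1 x hx y (by omega)
  · have := mul_mem (h1 y (by omega) x (by omega)) nSwap_mem
    convert this using 1
    exact end_ext_pair (by simp [end_mul_apply]) (by simp [end_mul_apply])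

lemma exists_move {x y : Letter} (h : x.1 ≠ y.1) :
    ∃ β ∈ nielsen, β (el x) = el x * el y ∧ β (el y) = el y := by
  have ht : (pairEnd (ga * gb) gb) ∈ nielsen := by
    have h0 : (pairEnd ga⁻¹ gb⁻¹) ∈ nielsen :=
      signedPerm_mem (x := (0, false)) (y := (1, false)) (by decide)
    have : (pairEnd (ga * gb) gb) =
        pairEnd ga⁻¹ gb⁻¹ * nTwist * pairEnd ga⁻¹ gb⁻¹ :=
      end_ext_pair (by simp [end_mul_apply]) (by simp [end_mul_apply])
    rw [this]; exact mul_mem (mul_mem h0 nTwist_mem) h0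
  have hs := signedPerm_mem h
  obtain ⟨s', hs', h1, h2⟩ := exists_nielsen_inv hs
  have ex : s' (el x) = ga := by
    have := congrArg (fun f : Monoid.End F2 => f ga) h2
    simpa [end_mul_apply, end_one_apply] using this
  have ey : s' (el y) = gb := by
    have := congrArg (fun f : Monoid.End F2 => f gb) h2
    simpa [end_mul_apply, end_one_apply] using this
  refine ⟨_, mul_mem (mul_mem hs ht) hs', ?_, ?_⟩
  · simp [end_mul_apply, ex]
  · simp [end_mul_apply, ey]

lemma exists_move_left {x y : Letter} (h : x.1 ≠ y.1) :
    ∃ β ∈ nielsen, β (el x) = el y * el x ∧ β (el y) = el y := by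
  obtain ⟨β, hβ, h1, h2⟩ := exists_move (x := x.flip) (y := y.flip) h
  refine ⟨β, hβ, ?_, ?_⟩
  · simpa [el_flip] using congrArg (·⁻¹) h1
  · simpa [el_flip] using congrArg (·⁻¹) h2

/-- A pair of nontrivial elements with small cancellation in the sense of Nielsen. -/
structure NReduced (φ : Monoid.End F2) : Prop where
  left : ∀ x y : Letter, y ≠ x.flip → 2 * gp (φ (el x))⁻¹ (φ (el y)) ≤ (φ (el x)).norm
  right : ∀ x y : Letter, y ≠ x.flip → 2 * gp (φ (el x))⁻¹ (φ (el y)) ≤ (φ (el y)).norm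
  middle : ∀ x y z : Letter, y ≠ x.flip → z ≠ y.flip →
    gp (φ (el x))⁻¹ (φ (el y)) + gp (φ (el y))⁻¹ (φ (el z)) < (φ (el y)).norm

/-- First complexity of a pair. -/
def cx₁ (φ : Monoid.End F2) : ℕ := (φ ga).norm + (φ gb).norm
/-- Second complexity of a pair. -/
def cx₂ (φ : Monoid.End F2) : ℕ := (φ ga * φ ga).norm + (φ gb * φ gb).norm

lemma norm_el_of_fst_eq (φ : Monoid.End F2) {x y : Letter} (h : x.1 = y.1) :
    (φ (el x)).norm = (φ (el y)).norm := by
  rcases Letter.eq_or_eq_flip h with rfl | rfl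
  · rfl
  · rw [el_flip, map_inv, FreeGroup.norm_inv_eq]

lemma norm_sq_el_of_fst_eq (φ : Monoid.End F2) {x y : Letter} (h : x.1 = y.1) :
    (φ (el x) * φ (el x)).norm = (φ (el y) * φ (el y)).norm := by
  rcases Letter.eq_or_eq_flip h with rfl | rfl
  · rfl
  · rw [el_flip, map_inv, ← mul_inv_rev, FreeGroup.norm_inv_eq]

lemma cx₁_eq (φ : Monoid.End F2) {x y : Letter} (h : x.1 ≠ y.1) :
    cx₁ φ = (φ (el x)).norm + (φ (el y)).norm := by
  rw [cx₁, ← el_zero_true, ← el_one_true]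
  by_cases hx : x.1 = 0
  · rw [norm_el_of_fst_eq φ (x := x) (y := (0, true)) hx,
      norm_el_of_fst_eq φ (x := y) (y := (1, true)) (by show y.1 = 1; omega)]
  · rw [norm_el_of_fst_eq φ (x := y) (y := (0, true)) (by show y.1 = 0; omega),
      norm_el_of_fst_eq φ (x := x) (y := (1, true)) (by show x.1 = 1; omega), add_comm]

lemma cx₂_eq (φ : Monoid.End F2) {x y : Letter} (h : x.1 ≠ y.1) :
    cx₂ φ = (φ (el x) * φ (el x)).norm + (φ (el y) * φ (el y)).norm := by
  rw [cx₂, ← el_zero_true, ← el_one_true]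
  by_cases hx : x.1 = 0
  · rw [norm_sq_el_of_fst_eq φ (x := x) (y := (0, true)) hx,
      norm_sq_el_of_fst_eq φ (x := y) (y := (1, true)) (by show y.1 = 1; omega)]
  · rw [norm_sq_el_of_fst_eq φ (x := y) (y := (0, true)) (by show y.1 = 0; omega),
      norm_sq_el_of_fst_eq φ (x := x) (y := (1, true)) (by show x.1 = 1; omega), add_comm]

lemma nReduced_of_minimal {φ : Monoid.End F2} (h1 : ∀ β ∈ nielsen, cx₁ φ ≤ cx₁ (φ * β))
    (h2 : ∀ β ∈ nielsen, cx₁ φ = cx₁ (φ * β) → cx₂ φ ≤ cx₂ (φ * β))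
    (ha : φ ga ≠ 1) (hb : φ gb ≠ 1) : NReduced φ := by
  have hne : ∀ x : Letter, φ (el x) ≠ 1 := by
    rintro ⟨i, b⟩
    fin_cases i <;> cases b <;>
      simp [el_zero_true, el_zero_false, el_one_true, el_one_false, ha, hb]
  have key : ∀ x y : Letter, x.1 ≠ y.1 → (φ (el x)).norm ≤ (φ (el x) * φ (el y)).norm := by
    intro x y h
    obtain ⟨β, hβ, e1, e2⟩ := exists_move h
    have := h1 β hβ
    rw [cx₁_eq _ h, cx₁_eq _ h, end_mul_apply, end_mul_apply, e1, e2, map_mul] at this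
    omega
  have key' : ∀ x y : Letter, x.1 ≠ y.1 → (φ (el y)).norm ≤ (φ (el x) * φ (el y)).norm := by
    intro x y h
    have := key y.flip x.flip h.symm
    rwa [el_flip, el_flip, map_inv, map_inv, ← mul_inv_rev, FreeGroup.norm_inv_eq,
      FreeGroup.norm_inv_eq] at this
  have hS : ∀ x : Letter, 2 * gp (φ (el x))⁻¹ (φ (el x)) < (φ (el x)).norm := by
    intro x
    have := norm_lt_norm_mul_self (hne x)
    have := norm_mul_add (φ (el x)) (φ (el x))
    omega
  have hL : ∀ x y : Letter, y ≠ x.flip → 2 * gp (φ (el x))⁻¹ (φ (el y)) ≤ (φ (el x)).norm := by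
    intro x y h
    by_cases hxy : x.1 = y.1
    · rcases Letter.eq_or_eq_flip hxy.symm with rfl | rfl
      · exact (hS _).le
      · exact absurd rfl h
    · have := key' x y hxy
      have := norm_mul_add (φ (el x)) (φ (el y))
      omega
  have hR : ∀ x y : Letter, y ≠ x.flip → 2 * gp (φ (el x))⁻¹ (φ (el y)) ≤ (φ (el y)).norm := by
    intro x y h
    by_cases hxy : x.1 = y.1
    · rcases Letter.eq_or_eq_flip hxy.symm with rfl | rfl
      · exact (hS _).le
      · exact absurd rfl h
    · have := key x y hxy
      have := norm_mul_add (φ (el x)) (φ (el y))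
      omega
  refine ⟨hL, hR, fun x y z hxy hyz => ?_⟩
  have r1 := hR x y hxy
  have r2 := hL y z hyz
  have sy := hS y
  by_cases exy : x.1 = y.1
  · rcases Letter.eq_or_eq_flip exy.symm with rfl | rfl
    · omega
    · exact absurd rfl hxy
  by_cases eyz : y.1 = z.1
  · rcases Letter.eq_or_eq_flip eyz.symm with rfl | rfl
    · omega
    · exact absurd rfl hyz
  by_contra! hcon
  rcases Letter.eq_or_eq_flip (Letter.fst_eq_of_ne exy eyz).symm with rfl | rfl
  · have c1 := gp_comm (φ (el z)) (φ (el z))⁻¹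
    have c2 := gp_comm (φ (el y))⁻¹ (φ (el z))
    have u1 := gp_ultra (φ (el y))⁻¹ (φ (el z)) (φ (el z))⁻¹
    have u2 := gp_ultra (φ (el y))⁻¹ (φ (el z))⁻¹ (φ (el y))
    have l1 := hL z y hxy
    have hlt : gp (φ (el z))⁻¹ (φ (el z)) < gp (φ (el z))⁻¹ (φ (el y)) := by omega
    obtain ⟨β, hβ, e1, e2⟩ := exists_move_left exy
    have n1 := norm_mul_add (φ (el y)) (φ (el z))
    have m1 := h2 β hβ
    rw [cx₁_eq _ exy, cx₁_eq _ exy, cx₂_eq _ exy, cx₂_eq _ exy, end_mul_apply, end_mul_apply,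
      e1, e2, map_mul] at m1
    have m2 := m1 (by omega)
    have n2 := norm_mul_add (φ (el z)) (φ (el z))
    have n3 := norm_mul_add (φ (el y) * φ (el z)) (φ (el y) * φ (el z))
    have n4 := norm_inv_mul (φ (el y)) (φ (el y) * φ (el z))
    rw [inv_mul_cancel_left] at n4
    have n5 := norm_inv_mul (φ (el z))⁻¹ (φ (el y) * φ (el z))⁻¹
    rw [mul_inv_rev, inv_inv, mul_inv_cancel_left, ← mul_inv_rev, FreeGroup.norm_inv_eq,
      FreeGroup.norm_inv_eq, FreeGroup.norm_inv_eq] at n5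
    have u3 := gp_ultra (φ (el y) * φ (el z))⁻¹ (φ (el z))⁻¹ (φ (el y))
    have u4 := gp_ultra (φ (el y) * φ (el z))⁻¹ (φ (el y)) (φ (el y) * φ (el z))
    have c3 := gp_comm (φ (el y) * φ (el z))⁻¹ (φ (el z))⁻¹
    omega
  · rw [el_flip, map_inv] at hcon r2
    have c2 := gp_comm (φ (el y))⁻¹ (φ (el x))⁻¹
    have u2 := gp_ultra (φ (el y))⁻¹ (φ (el x))⁻¹ (φ (el y))
    omega

lemma exists_nielsen_reduced (f : Monoid.End F2) :
    ∃ α ∈ nielsen, (f * α) ga = 1 ∨ (f * α) gb = 1 ∨ NReduced (f * α) := by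
  obtain ⟨α, hα, hmin⟩ := (InvImage.wf (fun α : Monoid.End F2 => toLex (cx₁ (f * α), cx₂ (f * α)))
    (wellFounded_lt (α := ℕ ×ₗ ℕ))).has_min {α | α ∈ nielsen} ⟨1, one_mem nielsen⟩
  refine ⟨α, hα, ?_⟩
  by_cases ha : (f * α) ga = 1
  · exact Or.inl ha
  by_cases hb : (f * α) gb = 1
  · exact Or.inr (Or.inl hb)
  refine Or.inr (Or.inr (nReduced_of_minimal ?_ ?_ ha hb))
  · intro β hβ
    have := hmin (α * β) (mul_mem hα hβ)
    simp only [InvImage, Prod.Lex.toLex_lt_toLex, ← mul_assoc] at this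
    omega
  · intro β hβ
    have := hmin (α * β) (mul_mem hα hβ)
    simp only [InvImage, Prod.Lex.toLex_lt_toLex, ← mul_assoc] at this
    omega

section Reduced
variable {φ : Monoid.End F2}

lemma NReduced.pos (hφ : NReduced φ) (x : Letter) : 0 < (φ (el x)).norm := by
  have h : x ≠ x.flip := by revert x; decide
  have := hφ.middle x x x h h
  omega

lemma NReduced.word (hφ : NReduced φ) (s : Letter) (l : List Letter)
    (hr : FreeGroup.IsReduced (s :: l)) :
    (∀ x : Letter, s ≠ x.flip →
      gp (φ (el x))⁻¹ (φ (FreeGroup.mk (s :: l))) = gp (φ (el x))⁻¹ (φ (el s))) ∧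
    (φ (el s)).norm ≤ (φ (FreeGroup.mk (s :: l))).norm ∧ (φ (FreeGroup.mk l)).norm ≤ (φ (FreeGroup.mk (s :: l))).norm := by
  induction l generalizing s with
  | nil =>
    refine ⟨fun x _ => rfl, le_rfl, ?_⟩
    simp [← FreeGroup.one_eq_mk]
  | cons t l ih =>
    have hr' : FreeGroup.IsReduced (t :: l) := by
      unfold FreeGroup.IsReduced at *; exact hr.tail
    have hst : t ≠ s.flip := by
      unfold FreeGroup.IsReduced at hr
      have := (List.isChain_cons_cons.1 hr).1
      rintro rfl
      simp [Letter.flip] at this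
    obtain ⟨i1, i2, i3⟩ := ih t hr'
    have j1 := i1 s hst
    have l1 := hφ.left s t hst
    have r1 := hφ.right s t hst
    rw [mk_cons s, map_mul]
    have n1 := norm_mul_add (φ (el s)) (φ (FreeGroup.mk (t :: l)))
    have n2 := norm_inv_mul (φ (el s)) (φ (el s) * φ (FreeGroup.mk (t :: l)))
    rw [inv_mul_cancel_left] at n2
    refine ⟨fun x hx => ?_, by omega, by omega⟩
    have m := hφ.middle x s t hx hst
    have u1 := gp_ultra (φ (el x))⁻¹ (φ (el s)) (φ (el s) * φ (FreeGroup.mk (t :: l)))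
    have u2 := gp_ultra (φ (el x))⁻¹ (φ (el s) * φ (FreeGroup.mk (t :: l))) (φ (el s))
    have c := gp_comm (φ (el s) * φ (FreeGroup.mk (t :: l))) (φ (el s))
    omega

lemma NReduced.norm_le (hφ : NReduced φ) (l : List Letter) (hr : FreeGroup.IsReduced l)
    {s : Letter} (hs : s ∈ l) : (φ (el s)).norm ≤ (φ (FreeGroup.mk l)).norm := by
  induction l with
  | nil => simp at hs
  | cons t l ih =>
    have h := hφ.word t l hr
    rcases List.mem_cons.1 hs with rfl | hs
    · exact h.2.1
    · exact (ih (by unfold FreeGroup.IsReduced at *; exact hr.tail) hs).trans h.2.2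

lemma NReduced.injective (hφ : NReduced φ) : Function.Injective φ := by
  rw [injective_iff_map_eq_one]
  intro w hw
  have hr : FreeGroup.IsReduced w.toWord := isReduced_toWord
  by_contra h
  have hne : w.toWord ≠ [] := by simpa using h
  obtain ⟨s, l, e⟩ := List.exists_cons_of_ne_nil hne
  have h1 := hφ.norm_le w.toWord hr (s := s) (by simp [e])
  rw [mk_toWord, hw, FreeGroup.norm_one] at h1
  have := hφ.pos s
  omega

lemma mk_mem_zpowers (i : Fin 2) (l : List Letter) (h : ∀ s ∈ l, s.1 = i) :
    (FreeGroup.mk l : F2) ∈ Subgroup.zpowers (FreeGroup.of i : F2) := by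
  induction l with
  | nil => rw [← FreeGroup.one_eq_mk]; exact one_mem _
  | cons s l ih =>
    rw [mk_cons]
    refine mul_mem ?_ (ih fun t ht => h t (by simp [ht]))
    obtain ⟨j, b⟩ := s
    have : j = i := h (j, b) (by simp)
    subst this
    have hm := Subgroup.mem_zpowers (FreeGroup.of j : F2)
    cases b
    · have e : el (j, false) = (FreeGroup.of j)⁻¹ := el_flip (j, true)
      rw [e]; exact inv_mem hm
    · exact hm

/-- Elements with short image only involve generators with short image. -/
lemma NReduced.norm_le_or (hφ : NReduced φ) (i : Fin 2) (w : F2) :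
    (φ (FreeGroup.of i)).norm ≤ (φ w).norm ∨
      w ∈ Subgroup.zpowers (FreeGroup.of (i + 1) : F2) := by
  have hr : FreeGroup.IsReduced w.toWord := isReduced_toWord
  by_cases h : ∃ s ∈ w.toWord, s.1 = i
  · obtain ⟨s, hs, rfl⟩ := h
    left
    have := hφ.norm_le w.toWord hr hs
    rw [mk_toWord] at this
    rwa [norm_el_of_fst_eq φ (x := s) (y := (s.1, true)) rfl] at this
  · right
    push Not at h
    have := mk_mem_zpowers (i + 1) w.toWord fun s hs => by have := h s hs; omega
    rwa [mk_toWord] at this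

end Reduced

lemma not_commute_ga_gb : ¬ Commute ga gb := by
  unfold Commute SemiconjBy; decide

lemma commute_of_mem_zpowers {G : Type*} [Group G] {s x y : G} (hx : x ∈ Subgroup.zpowers s)
    (hy : y ∈ Subgroup.zpowers s) : Commute x y := by
  obtain ⟨m, rfl⟩ := hx
  obtain ⟨n, rfl⟩ := hy
  exact Commute.zpow_zpow_self s m n

lemma NReduced.norm_le_of_not_commute {φ : Monoid.End F2} (hφ : NReduced φ) {p q : F2}
    (h : ¬ Commute p q) (i : Fin 2) :
    (φ (FreeGroup.of i)).norm ≤ max (φ p).norm (φ q).norm := by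
  rcases hφ.norm_le_or i p with h1 | h1
  · exact h1.trans (le_max_left _ _)
  rcases hφ.norm_le_or i q with h2 | h2
  · exact h2.trans (le_max_right _ _)
  exact absurd (commute_of_mem_zpowers h1 h2) h

lemma exists_el_of_norm_eq_one {w : F2} (h : w.norm = 1) : ∃ x : Letter, w = el x := by
  rw [FreeGroup.norm, List.length_eq_one_iff] at h
  obtain ⟨x, hx⟩ := h
  exact ⟨x, by rw [el, ← hx, mk_toWord]⟩

lemma NReduced.mem_nielsen {φ : Monoid.End F2} (hφ : NReduced φ) (hs : Function.Surjective φ) :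
    φ ∈ nielsen := by
  obtain ⟨p, hp⟩ := hs ga
  obtain ⟨q, hq⟩ := hs gb
  have hpq : ¬ Commute p q := fun h => not_commute_ga_gb (by rw [← hp, ← hq]; exact h.map φ)
  have h1 := fun i => hφ.norm_le_of_not_commute hpq i
  simp only [hp, hq, FreeGroup.norm_of, max_self] at h1
  have h0 : ∀ i b, (φ (el (i, b))).norm = 1 := fun i b => by
    have := h1 i
    have := hφ.pos (i, b)
    have := norm_el_of_fst_eq φ (x := (i, b)) (y := (i, true)) rfl
    change _ = (φ (FreeGroup.of i)).norm at this
    omega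
  obtain ⟨x, hx⟩ := exists_el_of_norm_eq_one (h0 0 true)
  obtain ⟨y, hy⟩ := exists_el_of_norm_eq_one (h0 1 true)
  have hxy : x.1 ≠ y.1 := by
    intro h
    have hinj := hφ.injective
    rcases Letter.eq_or_eq_flip h with rfl | rfl
    · have := hinj (hx.trans hy.symm)
      revert this; decide
    · rw [el_flip, ← hy, ← map_inv] at hx
      have := hinj hx
      revert this; decide
  rw [show φ = pairEnd (el x) (el y) from ?_]
  · exact signedPerm_mem hxy
  · rw [← hx, ← hy]; exact eq_pairHom φ

lemma mem_nielsen_of_surjective {f : Monoid.End F2} (hf : Function.Surjective f) :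
    f ∈ nielsen := by
  obtain ⟨α, hα, h⟩ := exists_nielsen_reduced f
  have hs : Function.Surjective (f * α) := hf.comp (bijective_of_mem_nielsen hα).2
  have cyc : ∀ s : F2, (∀ w, (f * α) w ∈ Subgroup.zpowers s) → False := by
    intro s h
    obtain ⟨p, hp⟩ := hs ga
    obtain ⟨q, hq⟩ := hs gb
    exact not_commute_ga_gb (commute_of_mem_zpowers (s := s) (hp ▸ h p) (hq ▸ h q))
  have rng : ∀ (s : F2), (f * α) ga ∈ Subgroup.zpowers s → (f * α) gb ∈ Subgroup.zpowers s →
      ∀ w, (f * α) w ∈ Subgroup.zpowers s := by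
    intro s h1 h2 w
    induction w using FreeGroup.induction_on with
    | C1 => rw [map_one]; exact one_mem _
    | of i => fin_cases i <;> assumption
    | inv_of i h => rw [map_inv]; exact inv_mem h
    | mul x y hx hy => rw [map_mul]; exact mul_mem hx hy
  rcases h with h | h | h
  · exact (cyc _ (rng ((f * α) gb) (h ▸ one_mem _) (Subgroup.mem_zpowers _))).elim
  · exact (cyc _ (rng ((f * α) ga) (Subgroup.mem_zpowers _) (h ▸ one_mem _))).elim
  · exact mem_nielsen_of_mul_mem hα (h.mem_nielsen hs)

lemma range_le_zpowers {f : Monoid.End F2} {s : F2} (h1 : f ga ∈ Subgroup.zpowers s)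
    (h2 : f gb ∈ Subgroup.zpowers s) (w : F2) : f w ∈ Subgroup.zpowers s := by
  induction w using FreeGroup.induction_on with
  | C1 => rw [map_one]; exact one_mem _
  | of i => fin_cases i <;> assumption
  | inv_of i h => rw [map_inv]; exact inv_mem h
  | mul x y hx hy => rw [map_mul]; exact mul_mem hx hy

/-- An endomorphism is injective or has cyclic image. -/
lemma injective_or_cyclic (f : Monoid.End F2) :
    Function.Injective f ∨ ∃ s, ∀ w, f w ∈ Subgroup.zpowers s := by
  obtain ⟨α, hα, h⟩ := exists_nielsen_reduced f
  have back : ∀ s : F2, (∀ w, (f * α) w ∈ Subgroup.zpowers s) →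
      ∀ w, f w ∈ Subgroup.zpowers s := fun s h w => by
    obtain ⟨v, rfl⟩ := (bijective_of_mem_nielsen hα).2 w
    exact h v
  rcases h with h | h | h
  · exact Or.inr ⟨_, back _ (range_le_zpowers (h ▸ one_mem _) (Subgroup.mem_zpowers _))⟩
  · exact Or.inr ⟨_, back _ (range_le_zpowers (Subgroup.mem_zpowers _) (h ▸ one_mem _))⟩
  · left
    have := h.injective
    intro x y hxy
    obtain ⟨x, rfl⟩ := (bijective_of_mem_nielsen hα).2 x
    obtain ⟨y, rfl⟩ := (bijective_of_mem_nielsen hα).2 y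
    rw [this (a₁ := x) (a₂ := y) hxy]

lemma pairEnd_injective {p q : F2} (h : ¬ Commute p q) : Function.Injective (pairEnd p q) := by
  rcases injective_or_cyclic (pairEnd p q) with h1 | ⟨s, hs⟩
  · exact h1
  · refine absurd (commute_of_mem_zpowers (s := s) ?_ ?_) h
    · simpa using hs ga
    · simpa using hs gb

lemma exists_zpow_of_commute {p q : F2} (h : Commute p q) :
    ∃ s : F2, ∃ i j : ℤ, p = s ^ i ∧ q = s ^ j := by
  rcases injective_or_cyclic (pairEnd p q) with h1 | ⟨s, hs⟩
  · refine absurd ?_ not_commute_ga_gb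
    apply h1
    simpa using h.eq
  · obtain ⟨i, hi⟩ := hs ga
    obtain ⟨j, hj⟩ := hs gb
    exact ⟨s, i, j, by simpa using hi.symm, by simpa using hj.symm⟩

/-- An endomorphism fixing two non-commuting elements is a Nielsen automorphism. -/
lemma mem_nielsen_of_fix {f : Monoid.End F2} {p q : F2} (h : ¬ Commute p q) (hp : f p = p)
    (hq : f q = q) : f ∈ nielsen := by
  have hpn : ∀ n : ℕ, (f ^ n) p = p := fun n => by
    induction n with
    | zero => rfl
    | succ n ih => rw [pow_succ, end_mul_apply, hp, ih]
  have hqn : ∀ n : ℕ, (f ^ n) q = q := fun n => by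
    induction n with
    | zero => rfl
    | succ n ih => rw [pow_succ, end_mul_apply, hq, ih]
  set N := max p.norm q.norm
  have ex : ∀ n : ℕ, ∃ α ∈ nielsen, ((f ^ n * α) ga).norm ≤ N ∧ ((f ^ n * α) gb).norm ≤ N := by
    intro n
    obtain ⟨α, hα, hr⟩ := exists_nielsen_reduced (f ^ n)
    obtain ⟨p', hp'⟩ := (bijective_of_mem_nielsen hα).2 p
    obtain ⟨q', hq'⟩ := (bijective_of_mem_nielsen hα).2 q
    have ep : (f ^ n * α) p' = p := by rw [end_mul_apply, hp', hpn]
    have eq : (f ^ n * α) q' = q := by rw [end_mul_apply, hq', hqn]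
    have cyc : ∀ s : F2, (∀ w, (f ^ n * α) w ∈ Subgroup.zpowers s) → False := fun s hs =>
      h (commute_of_mem_zpowers (s := s) (ep ▸ hs p') (eq ▸ hs q'))
    refine ⟨α, hα, ?_⟩
    rcases hr with hr | hr | hr
    · exact (cyc _ (range_le_zpowers (hr ▸ one_mem _) (Subgroup.mem_zpowers _))).elim
    · exact (cyc _ (range_le_zpowers (Subgroup.mem_zpowers _) (hr ▸ one_mem _))).elim
    · have hc : ¬ Commute p' q' := fun hc => h (by rw [← ep, ← eq]; exact hc.map _)
      have := fun i => hr.norm_le_of_not_commute hc i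
      simp only [ep, eq] at this
      exact ⟨this 0, this 1⟩
  choose α hα h1 h2 using ex
  have hm : Set.MapsTo (fun n : ℕ => ((f ^ n * α n) ga, (f ^ n * α n) gb)) Set.univ
      ({w : F2 | w.norm ≤ N} ×ˢ {w : F2 | w.norm ≤ N}) := fun n _ => ⟨h1 n, h2 n⟩
  obtain ⟨n, -, m, -, hnm, e⟩ :=
    Set.infinite_univ.exists_lt_map_eq_of_mapsTo hm ((finite_ball N).prod (finite_ball N))
  have e' : f ^ n * α n = f ^ m * α m :=
    end_ext_pair (congrArg Prod.fst e) (congrArg Prod.snd e)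
  have hinj : Function.Injective f := by
    rcases injective_or_cyclic f with h1 | ⟨s, hs⟩
    · exact h1
    · exact absurd (commute_of_mem_zpowers (s := s) (hp ▸ hs p) (hq ▸ hs q)) h
  have hinjn : Function.Injective (f ^ n) := by
    rw [Monoid.End.coe_pow]; exact hinj.iterate n
  obtain ⟨k, rfl⟩ : ∃ k, m = n + (k + 1) := ⟨m - n - 1, by omega⟩
  have e2 : α n = f * (f ^ k * α (n + (k + 1))) := by
    refine MonoidHom.ext fun i => hinjn ?_
    have := congrArg (fun g : Monoid.End F2 => g i) e'
    rw [pow_add, pow_succ' f k] at this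
    exact this
  apply mem_nielsen_of_surjective
  intro y
  obtain ⟨x, hx⟩ := (bijective_of_mem_nielsen (hα n)).2 y
  exact ⟨_, by rw [← hx, e2]; rfl⟩


/-- The commutator of the generators that acts as the central translation. -/
def gc : F2 := gb⁻¹ * ga⁻¹ * gb * ga

/-- A real-valued invariant preorder on the free group, invariant on the right under `gc`. -/
structure Compat (o : F2 → ℝ) : Prop where
  left : ∀ g x y, o x < o y → o (g * x) < o (g * y)
  right : ∀ x y, o x < o y → o (x * gc) < o (y * gc)
  right_inv : ∀ x y, o x < o y → o (x * gc⁻¹) < o (y * gc⁻¹)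
  lt₀ : o 1 < o ga
  lt₁ : o ga < o (ga * gb)
  lt₂ : o (ga * gb) < o gb
  lt₃ : o gb < o gc

/-- The letter with a given index modulo four. -/
def lt (i : ℤ) : Letter :=
  if i % 4 = 0 then (1, false) else if i % 4 = 1 then (0, true)
    else if i % 4 = 2 then (1, true) else (0, false)

/-- The shift exponent of a letter. -/
def sh (i : ℤ) : ℤ := if i % 4 = 0 then -1 else if i % 4 = 2 then 1 else 0

/-- The bi-infinite sequence of vertices on the boundary line. -/
def vtx (i : ℤ) : F2 :=
  (if i % 4 = 0 then 1 else if i % 4 = 1 then ga else if i % 4 = 2 then ga * gb else gb)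
    * gc ^ (i / 4)

lemma int_cases_four (i : ℤ) : ∃ n : ℤ, i = 0 + 4 * n ∨ i = 1 + 4 * n ∨ i = 2 + 4 * n ∨
    i = 3 + 4 * n := ⟨i / 4, by omega⟩

lemma lt_add (i n : ℤ) : lt (i + 4 * n) = lt i := by simp [lt]
lemma sh_add (i n : ℤ) : sh (i + 4 * n) = sh i := by simp [sh]
lemma vtx_add (i n : ℤ) : vtx (i + 4 * n) = vtx i * gc ^ n := by
  have : (i + 4 * n) / 4 = i / 4 + n := by omega
  simp [vtx, this, zpow_add, mul_assoc]

lemma lt_eq_iff (i j : ℤ) : lt i = lt j ↔ i % 4 = j % 4 := by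
  obtain ⟨n, rfl | rfl | rfl | rfl⟩ := int_cases_four i <;>
  obtain ⟨m, rfl | rfl | rfl | rfl⟩ := int_cases_four j <;>
  simp only [lt_add, Int.add_mul_emod_self_left] <;> decide

lemma lt_add_two (i : ℤ) : lt (i + 2) = (lt i).flip := by
  obtain ⟨n, rfl | rfl | rfl | rfl⟩ := int_cases_four i <;>
  rw [add_right_comm, lt_add, lt_add] <;> decide

lemma exists_lt (x : Letter) : ∃ i, x = lt i := by
  have : x = lt 0 ∨ x = lt 1 ∨ x = lt 2 ∨ x = lt 3 := by revert x; decide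
  rcases this with h | h | h | h <;> exact ⟨_, h⟩

lemma vtx_zero : vtx 0 = 1 := by simp [vtx]
lemma vtx_one : vtx 1 = ga := by simp [vtx]
lemma vtx_two : vtx 2 = ga * gb := by simp [vtx]
lemma vtx_three : vtx 3 = gb := by simp [vtx]
lemma vtx_four : vtx 4 = gc := by simp [vtx]

lemma el_lt_mul_vtx_sub_one (i : ℤ) : el (lt i) * vtx (i - 1) = vtx (i + 4 * sh i) := by
  obtain ⟨n, h⟩ := int_cases_four i
  have key : ∀ r n, el (lt r) * vtx (r - 1) = vtx (r + 4 * sh r) →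
      el (lt (r + 4 * n)) * vtx (r + 4 * n - 1) = vtx (r + 4 * n + 4 * sh (r + 4 * n)) := by
    intro r n h
    rw [lt_add, sh_add, add_sub_right_comm, vtx_add, ← mul_assoc, h, ← vtx_add]; ring_nf
  rcases h with rfl | rfl | rfl | rfl <;> apply key <;> decide

lemma el_lt_mul_vtx_add_two (i : ℤ) : el (lt i) * vtx (i + 2) = vtx (i + 1 + 4 * sh i) := by
  obtain ⟨n, h⟩ := int_cases_four i
  have key : ∀ r n, el (lt r) * vtx (r + 2) = vtx (r + 1 + 4 * sh r) →
      el (lt (r + 4 * n)) * vtx (r + 4 * n + 2) = vtx (r + 4 * n + 1 + 4 * sh (r + 4 * n)) := by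
    intro r n h
    rw [lt_add, sh_add, add_right_comm, vtx_add, ← mul_assoc, h, ← vtx_add]
    ring_nf
  rcases h with rfl | rfl | rfl | rfl <;> apply key <;> decide

section Compat
variable {o o' : F2 → ℝ}

lemma Compat.right_zpow (h : Compat o) (n : ℤ) {x y : F2} (hxy : o x < o y) :
    o (x * gc ^ n) < o (y * gc ^ n) := by
  induction n with
  | zero => simpa
  | succ n ih => rw [zpow_add_one, ← mul_assoc, ← mul_assoc]; exact h.right _ _ ih
  | pred n ih => rw [zpow_sub_one, ← mul_assoc, ← mul_assoc]; exact h.right_inv _ _ ih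

lemma Compat.strictMono (h : Compat o) : StrictMono fun i => o (vtx i) := by
  refine strictMono_int_of_lt_succ fun i => ?_
  obtain ⟨n, hi⟩ := int_cases_four i
  have key : ∀ r, o (vtx r) < o (vtx (r + 1)) →
      o (vtx (r + 4 * n)) < o (vtx (r + 4 * n + 1)) := fun r hr => by
    rw [add_right_comm, vtx_add, vtx_add]; exact h.right_zpow n hr
  rcases hi with rfl | rfl | rfl | rfl <;> apply key
  · rw [vtx_zero, zero_add, vtx_one]; exact h.lt₀
  · rw [vtx_one, one_add_one_eq_two, vtx_two]; exact h.lt₁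
  · rw [vtx_two, show (2 : ℤ) + 1 = 3 from rfl, vtx_three]; exact h.lt₂
  · rw [vtx_three, show (3 : ℤ) + 1 = 4 from rfl, vtx_four]; exact h.lt₃

lemma Compat.lt_iff (h : Compat o) {i j : ℤ} : o (vtx i) < o (vtx j) ↔ i < j :=
  h.strictMono.lt_iff_lt

/-- The closed arc between two consecutive vertices. -/
def InArc (o : F2 → ℝ) (i : ℤ) (y : F2) : Prop :=
  (o (vtx i) < o y ∧ o y < o (vtx (i + 1))) ∨ y = vtx i ∨ y = vtx (i + 1)

lemma Compat.inArc_step (h : Compat o) {i j : ℤ} (h1 : i - 1 ≤ j) (h2 : j ≤ i + 1) {y : F2}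
    (hy : InArc o j y) : InArc o (i + 4 * sh i) (el (lt i) * y) := by
  have e1 := el_lt_mul_vtx_sub_one i
  have e2 := el_lt_mul_vtx_add_two i
  have hmid : ∀ z, o (vtx (i - 1)) < o z → o z < o (vtx (i + 2)) →
      InArc o (i + 4 * sh i) (el (lt i) * z) := by
    intro z hz hz'
    have := h.left (el (lt i)) _ _ hz
    have := h.left (el (lt i)) _ _ hz'
    rw [InArc, add_right_comm, ← e1, ← e2]
    exact Or.inl ⟨by assumption, by assumption⟩
  have hv : ∀ k, i - 1 ≤ k → k ≤ i + 2 → InArc o (i + 4 * sh i) (el (lt i) * vtx k) := by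
    intro k hk hk'
    rcases hk.eq_or_lt with rfl | hk
    · rw [e1]; exact Or.inr (Or.inl rfl)
    rcases hk'.eq_or_lt with rfl | hk'
    · rw [e2, add_right_comm]; exact Or.inr (Or.inr rfl)
    exact hmid _ (h.lt_iff.2 hk) (h.lt_iff.2 hk')
  rcases hy with ⟨hy, hy'⟩ | rfl | rfl
  · exact hmid y ((h.strictMono.monotone h1).trans_lt hy)
      (hy'.trans_le (h.strictMono.monotone (by omega)))
  · exact hv _ h1 (by omega)
  · exact hv _ (by omega) (by omega)

lemma exists_inArc_mk (l : List Letter) (hr : FreeGroup.IsReduced l) (i : ℤ)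
    (hi : ∀ x ∈ l.getLast?, lt i ≠ x.flip) :
    ∃ j, l.head?.getD (lt i) = lt j ∧
      ∀ o, Compat o → ∀ y, InArc o i y → InArc o j (FreeGroup.mk l * y) := by
  induction l with
  | nil => exact ⟨i, rfl, fun o _ y hy => by rwa [← FreeGroup.one_eq_mk, one_mul]⟩
  | cons x l ih =>
    obtain ⟨j, hj, H⟩ := ih (by unfold FreeGroup.IsReduced at *; exact hr.tail) (by
      intro y hy
      apply hi
      cases l with
      | nil => simp at hy
      | cons z l => simpa [List.getLast?_cons_cons] using hy)
    have hne : lt j ≠ x.flip := by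
      rw [← hj]
      cases l with
      | nil => exact hi x (by simp)
      | cons t l =>
        unfold FreeGroup.IsReduced at hr
        have := (List.isChain_cons_cons.1 hr).1
        simp only [List.head?_cons, Option.getD_some]
        rintro rfl
        simp [Letter.flip] at this
    obtain ⟨k, rfl⟩ := exists_lt x
    rw [← lt_add_two, Ne, lt_eq_iff] at hne
    obtain ⟨k', hk', h1, h2⟩ : ∃ k', k' % 4 = k % 4 ∧ k' - 1 ≤ j ∧ j ≤ k' + 1 := by
      have : j % 4 = k % 4 ∨ (j + 1) % 4 = k % 4 ∨ (j - 1) % 4 = k % 4 := by omega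
      rcases this with h | h | h
      · exact ⟨j, h, by omega, by omega⟩
      · exact ⟨j + 1, h, by omega, by omega⟩
      · exact ⟨j - 1, h, by omega, by omega⟩
    rw [← lt_eq_iff] at hk'
    refine ⟨k' + 4 * sh k', by rw [lt_add, hk']; rfl, fun o ho y hy => ?_⟩
    rw [mk_cons, ← hk', mul_assoc]
    exact ho.inArc_step h1 h2 (H o ho y hy)

/-- Every nontrivial element lies in an arc determined by the element and indexed by its first
letter. -/
lemma exists_inArc {y : F2} (hy : y ≠ 1) :
    ∃ j, y.toWord.head? = some (lt j) ∧ ∀ o, Compat o → InArc o j y := by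
  have hne : y.toWord ≠ [] := by simpa using hy
  obtain ⟨i, hi, hl⟩ : ∃ i : ℤ, (i = 0 ∨ i = -1) ∧ ∀ x ∈ y.toWord.getLast?, lt i ≠ Letter.flip x := by
    rw [List.getLast?_eq_some_getLast hne]
    by_cases h : lt 0 = Letter.flip (y.toWord.getLast hne)
    · refine ⟨-1, Or.inr rfl, fun x hx => ?_⟩
      simp only [Option.mem_def, Option.some.injEq] at hx
      rw [← hx, ← h]; decide
    · refine ⟨0, Or.inl rfl, fun x hx => ?_⟩
      simp only [Option.mem_def, Option.some.injEq] at hx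
      rwa [← hx]
  obtain ⟨j, hj, H⟩ := exists_inArc_mk y.toWord isReduced_toWord i hl
  refine ⟨j, ?_, fun o ho => ?_⟩
  · obtain ⟨x, l, e⟩ := List.exists_cons_of_ne_nil hne
    rw [e] at hj ⊢
    simpa using hj
  · have := H o ho 1 (by
      right
      rcases hi with rfl | rfl
      · exact Or.inl vtx_zero.symm
      · exact Or.inr (by simpa using vtx_zero.symm))
    rwa [mk_toWord, mul_one] at this

lemma Compat.left_iff (h : Compat o) (g : F2) {x y : F2} : o (g * x) < o (g * y) ↔ o x < o y := by
  refine ⟨fun hxy => ?_, h.left g x y⟩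
  simpa using h.left g⁻¹ _ _ hxy

lemma Compat.injective (h : Compat o) : Function.Injective o := by
  have key : ∀ y, y ≠ 1 → o y ≠ o 1 := by
    intro y hy e
    obtain ⟨j, -, H⟩ := exists_inArc hy
    rw [← vtx_zero] at e
    rcases H o h with ⟨h1, h2⟩ | rfl | rfl
    · rw [e, h.lt_iff] at h1 h2
      omega
    · rw [h.strictMono.injective e] at hy
      exact hy vtx_zero
    · rw [h.strictMono.injective e] at hy
      exact hy vtx_zero
  intro x y e
  by_contra hne
  have : x⁻¹ * y ≠ 1 := by rwa [Ne, inv_mul_eq_one]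
  rcases (key _ this).lt_or_gt with h1 | h1
  · have := h.left x _ _ h1; simp [e] at this
  · have := h.left x _ _ h1; simp [e] at this

lemma Compat.one_lt_imp (h : Compat o) (h' : Compat o') {y : F2} (hy : o 1 < o y) :
    o' 1 < o' y := by
  have hne : y ≠ 1 := by rintro rfl; exact lt_irrefl _ hy
  obtain ⟨j, -, H⟩ := exists_inArc hne
  have hj : 0 ≤ j := by
    by_contra hj
    have h0 : o (vtx (j + 1)) ≤ o (vtx 0) := h.strictMono.monotone (by omega)
    rw [vtx_zero] at h0
    rcases H o h with ⟨h1, h2⟩ | rfl | rfl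
    · linarith
    · have := h.lt_iff.2 (lt_add_one j); linarith
    · linarith
  have h0 : o' (vtx 0) ≤ o' (vtx j) := h'.strictMono.monotone hj
  rw [vtx_zero] at h0
  refine lt_of_le_of_ne ?_ fun e => hne (h'.injective e).symm
  rcases H o' h' with ⟨h1, h2⟩ | rfl | rfl
  · linarith
  · exact h0
  · have := h'.lt_iff.2 (lt_add_one j); linarith

/-- All compatible orders agree. -/
lemma Compat.lt_imp (h : Compat o) (h' : Compat o') {x y : F2} (hxy : o x < o y) :
    o' x < o' y := by
  rw [← h.left_iff x⁻¹, inv_mul_cancel] at hxy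
  have := h.one_lt_imp h' hxy
  rwa [← h'.left_iff x⁻¹, inv_mul_cancel]

end Compat

section Existence

/-- A piecewise linear homeomorphism of the line commuting with the unit translation. -/
noncomputable def plFun (t : ℝ) : ℝ :=
  ⌊t⌋ + max (1 / 4 + Int.fract t / 3) (3 * Int.fract t - 7 / 4)

lemma plFun_add_one (t : ℝ) : plFun (t + 1) = plFun t + 1 := by
  simp only [plFun, Int.floor_add_one, Int.fract_add_one]; push_cast; ring

lemma plFun_low {t : ℝ} (n : ℤ) (h : n ≤ t) (h' : t ≤ n + 3 / 4) :
    plFun t = n + 1 / 4 + (t - n) / 3 := by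
  have e : ⌊t⌋ = n := by rw [Int.floor_eq_iff]; exact ⟨h, by linarith⟩
  rw [plFun, Int.fract, e, max_eq_left (by linarith)]; ring

lemma plFun_high {t : ℝ} (n : ℤ) (h : n + 3 / 4 ≤ t) (h' : t ≤ n + 1) :
    plFun t = n + 3 * (t - n) - 7 / 4 := by
  rcases h'.eq_or_lt with h' | h'
  · rw [plFun_low (n + 1) (by push_cast; linarith) (by push_cast; linarith)]
    push_cast; rw [h']; ring
  · have e : ⌊t⌋ = n := by rw [Int.floor_eq_iff]; exact ⟨by linarith, by linarith⟩
    rw [plFun, Int.fract, e, max_eq_right (by linarith)]; ring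

lemma monotone_plFun : Monotone plFun := by
  intro t s hts
  have h1 := Int.floor_mono hts
  have f1 := Int.fract_lt_one t
  have f2 := Int.fract_nonneg s
  rcases h1.eq_or_lt with h | h
  · have : Int.fract t ≤ Int.fract s := by rw [Int.fract, Int.fract, h]; linarith
    rw [plFun, plFun, h]
    gcongr
  · have h' : (⌊t⌋ : ℝ) + 1 ≤ ⌊s⌋ := by exact_mod_cast h
    have a1 : max (1 / 4 + Int.fract t / 3) (3 * Int.fract t - 7 / 4) ≤ 5 / 4 :=
      max_le (by linarith) (by linarith)
    have a2 := le_max_left (1 / 4 + Int.fract s / 3) (3 * Int.fract s - 7 / 4)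
    rw [plFun, plFun]
    linarith

lemma plFun_left_inv (t : ℝ) : plFun (plFun t + 1 / 2) - 1 / 2 = t := by
  have h0 := Int.floor_le t
  have h1 := Int.lt_floor_add_one t
  rcases le_total t (⌊t⌋ + 3 / 4) with h | h
  · rw [plFun_low _ h0 h, plFun_high ⌊t⌋ (by linarith) (by linarith)]; ring
  · rw [plFun_high _ h h1.le, plFun_low (⌊t⌋ + 1) (by push_cast; linarith)
      (by push_cast; linarith)]
    push_cast; ring

lemma plFun_right_inv (t : ℝ) : plFun (plFun (t + 1 / 2) - 1 / 2) = t := by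
  have h1 := plFun_left_inv (t + 1 / 2)
  have h2 := plFun_add_one (plFun (t + 1 / 2) - 1 / 2)
  rw [show plFun (t + 1 / 2) - 1 / 2 + 1 = plFun (t + 1 / 2) + 1 / 2 by ring] at h2
  linarith

/-- The order automorphism given by `plFun`. -/
noncomputable def plIso : ℝ ≃o ℝ :=
  Equiv.toOrderIso ⟨plFun, fun t => plFun (t + 1 / 2) - 1 / 2, plFun_left_inv, plFun_right_inv⟩
    monotone_plFun fun _ _ h => sub_le_sub_right (monotone_plFun (add_le_add_left h _)) _

lemma plIso_apply (t : ℝ) : plIso t = plFun t := rfl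

/-- The action of the free group on the line. -/
noncomputable def lineAction : F2 →* (ℝ ≃o ℝ) :=
  pairHom plIso (OrderIso.addRight (1 / 4 : ℝ) * plIso * OrderIso.addRight (3 / 4 : ℝ))

lemma lineAction_ga (t : ℝ) : lineAction ga t = plFun t := by
  rw [lineAction, pairHom_ga, plIso_apply]

lemma lineAction_gb (t : ℝ) : lineAction gb t = plFun (t + 3 / 4) + 1 / 4 := by
  rw [lineAction, pairHom_gb]; rfl

lemma lineAction_mul (g h : F2) (t : ℝ) : lineAction (g * h) t = lineAction g (lineAction h t) := by
  rw [map_mul]; rfl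

lemma lineAction_one (t : ℝ) : lineAction 1 t = t := by
  rw [map_one]; rfl

lemma lineAction_add_one (g : F2) (t : ℝ) : lineAction g (t + 1) = lineAction g t + 1 := by
  have hinv : ∀ g : F2, (∀ t, lineAction g (t + 1) = lineAction g t + 1) →
      ∀ t, lineAction g⁻¹ (t + 1) = lineAction g⁻¹ t + 1 := fun g h t => by
    apply (lineAction g).injective
    rw [h, ← lineAction_mul, ← lineAction_mul, mul_inv_cancel, lineAction_one, lineAction_one]
  have hof : ∀ i t, lineAction (FreeGroup.of i) (t + 1) = lineAction (FreeGroup.of i) t + 1 := by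
    intro i t
    fin_cases i
    · exact (lineAction_ga _).trans ((plFun_add_one _).trans (by rw [← lineAction_ga]; rfl))
    · refine (lineAction_gb _).trans (Eq.trans ?_ (congrArg (· + 1) (lineAction_gb t).symm))
      rw [add_right_comm, plFun_add_one]; ring
  induction g using FreeGroup.induction_on generalizing t with
  | C1 => rw [lineAction_one, lineAction_one]
  | of i => exact hof i t
  | inv_of i _ => exact hinv _ (hof i) t
  | mul x y hx hy => rw [lineAction_mul, hy, hx, lineAction_mul]

/-- The orbit map at the origin. -/
noncomputable def ord (g : F2) : ℝ := lineAction g 0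

lemma ord_one : ord 1 = 0 := lineAction_one 0
lemma ord_ga_mul (g : F2) : ord (ga * g) = plFun (ord g) := by
  rw [ord, lineAction_mul, lineAction_ga, ord]
lemma ord_gb_mul (g : F2) : ord (gb * g) = plFun (ord g + 3 / 4) + 1 / 4 := by
  rw [ord, lineAction_mul, lineAction_gb, ord]

lemma ord_ga : ord ga = 1 / 4 := by
  rw [← mul_one ga, ord_ga_mul, ord_one, plFun_low 0] <;> norm_num
lemma ord_gb : ord gb = 3 / 4 := by
  rw [← mul_one gb, ord_gb_mul, ord_one, plFun_low 0] <;> norm_num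
lemma ord_ga_gb : ord (ga * gb) = 1 / 2 := by
  rw [ord_ga_mul, ord_gb, plFun_low 0] <;> norm_num

lemma ord_gc : ord gc = 1 := by
  have e : ga * gb * gc = gb * ga := by decide
  apply (lineAction (ga * gb)).injective
  rw [ord, ← lineAction_mul, e]
  change ord (gb * ga) = _
  rw [ord_gb_mul, ord_ga, lineAction_mul, lineAction_ga, lineAction_gb, plFun_high 0,
    plFun_low 1, plFun_high 1] <;> norm_num [plFun_low 1]

lemma ord_mul_gc (g : F2) : ord (g * gc) = ord g + 1 := by
  have h := ord_gc
  rw [ord] at h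
  rw [ord, lineAction_mul, h, ← zero_add (1 : ℝ), lineAction_add_one, zero_add, ord]

lemma ord_mul_zpow (g : F2) (n : ℤ) : ord (g * gc ^ n) = ord g + n := by
  induction n with
  | zero => simp
  | succ n ih => rw [zpow_add_one, ← mul_assoc, ord_mul_gc, ih]; push_cast; ring
  | pred n ih =>
    have := ord_mul_gc (g * gc ^ (-(n : ℤ) - 1))
    rw [mul_assoc, ← zpow_add_one, sub_add_cancel, ih] at this
    push_cast at *
    linarith

lemma ord_mul_gc_inv (g : F2) : ord (g * gc⁻¹) = ord g - 1 := by
  have := ord_mul_zpow g (-1)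
  rw [zpow_neg_one] at this
  rw [this]; push_cast; ring

lemma compat_ord : Compat ord where
  left g x y h := by
    rw [ord, ord, lineAction_mul, lineAction_mul]
    exact (lineAction g).strictMono h
  right x y h := by rw [ord_mul_gc, ord_mul_gc]; linarith
  right_inv x y h := by rw [ord_mul_gc_inv, ord_mul_gc_inv]; linarith
  lt₀ := by rw [ord_one, ord_ga]; norm_num
  lt₁ := by rw [ord_ga, ord_ga_gb]; norm_num
  lt₂ := by rw [ord_ga_gb, ord_gb]; norm_num
  lt₃ := by rw [ord_gb, ord_gc]; norm_num

end Existence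

lemma map_mul_gc_zpow {φ : F2 → F2} {ε : ℤ} (h : ∀ x, φ (x * gc) = φ x * gc ^ ε) (x : F2) (n : ℤ) :
    φ (x * gc ^ n) = φ x * gc ^ (ε * n) := by
  induction n with
  | zero => simp
  | succ n ih => rw [zpow_add_one, ← mul_assoc, h, ih, mul_add_one, zpow_add, mul_assoc]
  | pred n ih =>
    have := h (x * gc ^ (-(n : ℤ) - 1))
    rw [mul_assoc, ← zpow_add_one, sub_add_cancel, ih] at this
    rw [mul_sub_one, zpow_sub gc (ε * _), ← mul_assoc, this, mul_inv_cancel_right]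

/-- An endomorphism is realised by a monotone or antitone twisted map `φ` of the ordered set. -/
structure Realizes (f : Monoid.End F2) (φ : F2 → F2) (χ : F2 → ℤ) (ε : ℤ) : Prop where
  surj : Function.Surjective φ
  equiv : ∀ g x, φ (g * x) = f g * φ x * gc ^ χ g
  gc_mul : ∀ x, φ (x * gc) = φ x * gc ^ ε
  mono : (ε = 1 ∧ ∀ x y, ord x < ord y → ord (φ x) < ord (φ y)) ∨
    (ε = -1 ∧ ∀ x y, ord x < ord y → ord (φ y) < ord (φ x))

section Realizes
variable {f f' : Monoid.End F2} {φ φ' : F2 → F2} {χ χ' : F2 → ℤ} {ε ε' : ℤ}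

lemma Realizes.gc_zpow (h : Realizes f φ χ ε) (x : F2) (n : ℤ) :
    φ (x * gc ^ n) = φ x * gc ^ (ε * n) := map_mul_gc_zpow h.gc_mul x n

lemma Realizes.mul (h : Realizes f φ χ ε) (h' : Realizes f' φ' χ' ε') :
    Realizes (f * f') (φ ∘ φ') (fun g => χ (f' g) + ε * χ' g) (ε * ε') where
  surj := h.surj.comp h'.surj
  equiv g x := by
    simp only [Function.comp, h'.equiv, h.gc_zpow]
    rw [h.equiv, end_mul_apply, zpow_add]
    group
  gc_mul x := by simp only [Function.comp, h'.gc_mul, h.gc_zpow]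
  mono := by
    rcases h.mono with ⟨e, m⟩ | ⟨e, m⟩ <;> rcases h'.mono with ⟨e', m'⟩ | ⟨e', m'⟩ <;>
      subst e <;> subst e'
    · exact Or.inl ⟨rfl, fun x y hxy => m _ _ (m' _ _ hxy)⟩
    · exact Or.inr ⟨rfl, fun x y hxy => m _ _ (m' _ _ hxy)⟩
    · exact Or.inr ⟨rfl, fun x y hxy => m _ _ (m' _ _ hxy)⟩
    · exact Or.inl ⟨rfl, fun x y hxy => m _ _ (m' _ _ hxy)⟩

lemma realizes_one : Realizes 1 id (fun _ => 0) 1 where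
  surj := Function.surjective_id
  equiv g x := by simp [end_one_apply]
  gc_mul x := by simp
  mono := Or.inl ⟨rfl, fun _ _ h => h⟩

lemma realizes_of_data (f : Monoid.End F2) (hf : Function.Surjective f) (h : F2)
    (χ : F2 →* Multiplicative ℤ) (ε : ℤ) (hε : ε = 1 ∨ ε = -1) (hc : f gc * h = h * gc ^ ε)
    (v₀ v₁ v₂ v₃ v₄ : F2) (e₀ : h = v₀) (e₁ : f ga * h * gc ^ (χ ga).toAdd = v₁)
    (e₂ : f (ga * gb) * h * gc ^ (χ (ga * gb)).toAdd = v₂)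
    (e₃ : f gb * h * gc ^ (χ gb).toAdd = v₃) (e₄ : f gc * h = v₄)
    (h₀ : 0 < ε * (ord v₁ - ord v₀)) (h₁ : 0 < ε * (ord v₂ - ord v₁))
    (h₂ : 0 < ε * (ord v₃ - ord v₂)) (h₃ : 0 < ε * (ord v₄ - ord v₃)) :
    Realizes f (fun g => f g * h * gc ^ (χ g).toAdd) (fun g => (χ g).toAdd) ε := by
  set φ : F2 → F2 := fun g => f g * h * gc ^ (χ g).toAdd with hφ
  have hχc : χ gc = 1 := by
    simp only [gc, map_mul, map_inv]
    rw [mul_right_comm, mul_comm (χ gb)⁻¹]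
    simp
  have hequiv : ∀ g x, φ (g * x) = f g * φ x * gc ^ (χ g).toAdd := fun g x => by
    simp only [hφ]
    rw [map_mul, map_mul, toAdd_mul, add_comm, zpow_add]
    group
  have hgc : ∀ x, φ (x * gc) = φ x * gc ^ ε := fun x => by
    have e : gc ^ ε * gc ^ (χ x).toAdd = gc ^ (χ x).toAdd * gc ^ ε :=
      (Commute.zpow_zpow_self gc _ _).eq
    simp only [hφ]
    rw [map_mul, map_mul, hχc, mul_one, mul_assoc (f x), hc, mul_assoc (f x * h), ← e]
    group
  have hgz := map_mul_gc_zpow hgc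
  have hcomp : Compat fun x => ε * ord (φ x) := by
    have key : ∀ x y g (n : ℤ), (ε : ℝ) * ord x < ε * ord y →
        (ε : ℝ) * ord (g * x * gc ^ n) < ε * ord (g * y * gc ^ n) := by
      intro x y g n hxy
      rw [ord_mul_zpow, ord_mul_zpow]
      rcases hε with rfl | rfl
      · have := compat_ord.left g x y (by simpa using hxy)
        simpa using this
      · have := compat_ord.left g y x (by simpa using hxy)
        push_cast; linarith
    have f₀ : φ 1 = v₀ := by simp [hφ, e₀]
    have f₄ : φ gc = v₄ := by simp [hφ, hχc, e₄]
    refine ⟨fun g x y hxy => ?_, fun x y hxy => ?_, fun x y hxy => ?_, ?_, ?_, ?_, ?_⟩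
    · simp only [hequiv]; exact key _ _ _ _ hxy
    · simp only [hgc]; simpa only [one_mul] using key _ _ 1 ε hxy
    · have h1 := hgz x (-1)
      have h2 := hgz y (-1)
      rw [zpow_neg_one] at h1 h2
      rw [h1, h2]; simpa only [one_mul] using key _ _ 1 (ε * -1) hxy
    · rw [f₀, show φ ga = v₁ from e₁]; linarith
    · rw [show φ ga = v₁ from e₁, show φ (ga * gb) = v₂ from e₂]; linarith
    · rw [show φ gb = v₃ from e₃, show φ (ga * gb) = v₂ from e₂]; linarith
    · rw [show φ gb = v₃ from e₃, f₄]; linarith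
  refine ⟨fun y => ?_, hequiv, hgc, ?_⟩
  · obtain ⟨x, hx⟩ := hf (y * h⁻¹)
    refine ⟨x * gc ^ (-ε * (χ x).toAdd), ?_⟩
    have hε2 : ε * ε = 1 := by rcases hε with rfl | rfl <;> rfl
    rw [hgz, ← mul_assoc ε, mul_neg, hε2]
    simp only [hφ, hx]
    group
  · rcases hε with rfl | rfl
    · exact Or.inl ⟨rfl, fun x y hxy => by simpa using compat_ord.lt_imp hcomp hxy⟩
    · exact Or.inr ⟨rfl, fun x y hxy => by simpa using compat_ord.lt_imp hcomp hxy⟩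

/-- Every Nielsen automorphism is realised. -/
lemma exists_realizes {f : Monoid.End F2} (hf : f ∈ nielsen) : ∃ φ χ ε, Realizes f φ χ ε := by
  induction hf using Submonoid.closure_induction with
  | one => exact ⟨_, _, _, realizes_one⟩
  | mul x y _ _ hx hy =>
    obtain ⟨φ, χ, ε, h⟩ := hx
    obtain ⟨φ', χ', ε', h'⟩ := hy
    exact ⟨_, _, _, h.mul h'⟩
  | mem x hx =>
    have e2 : ord (gb * (ga * gb)) = 19 / 12 := by
      rw [ord_gb_mul, ord_ga_gb, plFun_low 1] <;> norm_num
    rcases hx with rfl | rfl | rfl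
    · refine ⟨_, _, _, realizes_of_data nSwap (bijective_of_mem_nielsen nSwap_mem).2 1
        (pairHom (.ofAdd (-1)) (.ofAdd (-1))) (-1) (Or.inr rfl) (by decide)
        1 (gb * gc⁻¹) (ga * gb * gc⁻¹) (ga * gc⁻¹) (1 * gc⁻¹) (by decide) (by decide) (by decide)
        (by decide) (by decide) ?_ ?_ ?_ ?_⟩ <;>
      simp only [ord_mul_gc_inv, ord_one, ord_ga, ord_gb, ord_ga_gb] <;> norm_num
    · refine ⟨_, _, _, realizes_of_data nInv (bijective_of_mem_nielsen nInv_mem).2 gb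
        1 (-1) (Or.inr rfl) (by decide)
        gb (ga * gb) ga 1 (gb * gc⁻¹) (by decide) (by decide) (by decide)
        (by decide) (by decide) ?_ ?_ ?_ ?_⟩ <;>
      simp only [ord_mul_gc_inv, ord_one, ord_ga, ord_gb, ord_ga_gb] <;> norm_num
    · refine ⟨_, _, _, realizes_of_data nTwist (bijective_of_mem_nielsen nTwist_mem).2 1
        (pairHom (.ofAdd (-1)) 1) 1 (Or.inl rfl) (by decide)
        1 (ga * gb) (gb * (ga * gb) * gc⁻¹) gb gc (by decide) (by decide) (by decide)
        (by decide) (by decide) ?_ ?_ ?_ ?_⟩ <;>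
      simp only [ord_mul_gc_inv, ord_one, ord_gb, ord_ga_gb, e2, ord_gc] <;> norm_num

end Realizes


/-- Action on subsets by left multiplication and right translation by powers of `gc`. -/
def act (g : F2) (i : ℤ) (C : Set F2) : Set F2 := {x | g⁻¹ * x * gc ^ (-i) ∈ C}

section Act
variable {g h : F2} {i j : ℤ} {C D : Set F2}

lemma mem_act {x : F2} : x ∈ act g i C ↔ g⁻¹ * x * gc ^ (-i) ∈ C := Iff.rfl

lemma mul_mem_act {x : F2} : g * x * gc ^ i ∈ act g i C ↔ x ∈ C := by
  rw [mem_act]; group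

lemma act_act : act g i (act h j C) = act (g * h) (i + j) C := by
  ext x
  simp only [mem_act]
  rw [mul_inv_rev, neg_add, zpow_add]
  group

lemma act_one_zero : act 1 0 C = C := by
  ext x; simp [mem_act]

lemma act_compl : (act g i C)ᶜ = act g i Cᶜ := rfl

lemma act_mono (h : C ⊆ D) : act g i C ⊆ act g i D := fun _ hx => h hx

lemma act_subset_act : act g i C ⊆ act g i D ↔ C ⊆ D :=
  ⟨fun h _ hx => mul_mem_act.1 (h (mul_mem_act.2 hx)), act_mono⟩

lemma act_eq_comm : act g i C = D ↔ C = act g⁻¹ (-i) D := by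
  constructor
  · rintro rfl; rw [act_act, inv_mul_cancel, neg_add_cancel, act_one_zero]
  · rintro rfl; rw [act_act, mul_inv_cancel, add_neg_cancel, act_one_zero]

end Act

lemma ord_act_lt_iff (g : F2) (i : ℤ) {x y : F2} :
    ord (g * x * gc ^ i) < ord (g * y * gc ^ i) ↔ ord x < ord y := by
  rw [ord_mul_zpow, ord_mul_zpow, add_lt_add_iff_right, compat_ord.left_iff]

lemma ord_mul_lt_iff (g : F2) {x y : F2} : ord (g * x) < ord (g * y) ↔ ord x < ord y :=
  compat_ord.left_iff g

/-- A proper nonempty initial segment of the ordered group. -/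
structure IsCut (C : Set F2) : Prop where
  lower : ∀ x ∈ C, ∀ y, ord y < ord x → y ∈ C
  nonempty : ∃ x, x ∈ C
  proper : ∃ x, x ∉ C

section Cut
variable {C D : Set F2}

lemma IsCut.lt (hC : IsCut C) {x y : F2} (hx : x ∈ C) (hy : y ∉ C) : ord x < ord y := by
  by_contra! h
  rcases h.lt_or_eq with h | h
  · exact hy (hC.lower x hx y h)
  · exact hy (compat_ord.injective h ▸ hx)

lemma IsCut.act (hC : IsCut C) (g : F2) (i : ℤ) : IsCut (act g i C) where
  lower x hx y hxy := by
    refine hC.lower _ hx _ ?_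
    rwa [ord_act_lt_iff]
  nonempty := by
    obtain ⟨x, hx⟩ := hC.nonempty
    exact ⟨_, mul_mem_act.2 hx⟩
  proper := by
    obtain ⟨x, hx⟩ := hC.proper
    exact ⟨_, mt mul_mem_act.1 hx⟩

lemma IsCut.total (hC : IsCut C) (hD : IsCut D) : C ⊆ D ∨ D ⊆ C := by
  by_contra! h
  obtain ⟨h1, h2⟩ := h
  obtain ⟨x, hx, hx'⟩ := Set.not_subset.1 h1
  obtain ⟨y, hy, hy'⟩ := Set.not_subset.1 h2
  exact lt_asymm (hC.lt hx hy') (hD.lt hy hx')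

/-- The position of a cut on the real line. -/
noncomputable def cutPos (C : Set F2) : ℝ := sSup (ord '' C)

lemma IsCut.bddAbove (hC : IsCut C) : BddAbove (ord '' C) := by
  obtain ⟨y, hy⟩ := hC.proper
  exact ⟨ord y, by rintro _ ⟨x, hx, rfl⟩; exact (hC.lt hx hy).le⟩

lemma IsCut.le_cutPos (hC : IsCut C) {x : F2} (hx : x ∈ C) : ord x ≤ cutPos C :=
  le_csSup hC.bddAbove ⟨x, hx, rfl⟩

lemma cutPos_mono (hC : IsCut C) (hD : IsCut D) (h : C ⊆ D) : cutPos C ≤ cutPos D := by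
  obtain ⟨x, hx⟩ := hC.nonempty
  exact csSup_le_csSup hD.bddAbove ⟨_, x, hx, rfl⟩ (Set.image_mono h)

lemma IsCut.subset_of_lt (hC : IsCut C) (hD : IsCut D) (h : cutPos C < cutPos D) : C ⊆ D := by
  rcases hC.total hD with h' | h'
  · exact h'
  · exact absurd (cutPos_mono hD hC h') h.not_ge

lemma IsCut.cutPos_translate (hC : IsCut C) (i : ℤ) : cutPos (RankTwo.act 1 i C) = cutPos C + i := by
  have key : ∀ {C : Set F2} (_ : IsCut C) (i : ℤ), cutPos (RankTwo.act 1 i C) ≤ cutPos C + i := by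
    intro C hC i
    obtain ⟨x, hx⟩ := (hC.act 1 i).nonempty
    refine csSup_le ⟨_, x, hx, rfl⟩ ?_
    rintro _ ⟨y, hy, rfl⟩
    have := hC.le_cutPos hy
    rw [inv_one, one_mul, ord_mul_zpow] at this
    push_cast at this
    linarith
  refine le_antisymm (key hC i) ?_
  have := key (hC.act 1 i) (-i)
  rw [act_act, one_mul, neg_add_cancel, act_one_zero] at this
  push_cast at this
  linarith

/-- The cut `C` separates the consecutive vertices `i` and `i + 1` seen from `g`. -/
def At (C : Set F2) (g : F2) (i : ℤ) : Prop := g * vtx i ∈ C ∧ g * vtx (i + 1) ∉ C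

lemma ord_vtx_four (g : F2) (n : ℤ) : ord (g * vtx (4 * n)) = ord g + n := by
  have := vtx_add 0 n
  rw [zero_add, vtx_zero, one_mul] at this
  rw [this, ord_mul_zpow]

lemma ord_mul_vtx_lt_iff (g : F2) {i j : ℤ} : ord (g * vtx i) < ord (g * vtx j) ↔ i < j := by
  rw [ord_mul_lt_iff, compat_ord.lt_iff]

lemma IsCut.exists_at (hC : IsCut C) (g : F2) : ∃ i, At C g i := by
  obtain ⟨x, hx⟩ := hC.nonempty
  obtain ⟨y, hy⟩ := hC.proper
  obtain ⟨n, hn⟩ := exists_int_lt (ord x - ord g)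
  obtain ⟨m, hm⟩ := exists_int_gt (ord y - ord g)
  obtain ⟨i, hi, hi'⟩ := Int.exists_greatest_of_bdd (P := fun i => g * vtx i ∈ C)
    ⟨4 * m, fun z hz => by
      have := hC.lt hz hy
      by_contra! h
      rw [← ord_mul_vtx_lt_iff g, ord_vtx_four] at h
      linarith⟩
    ⟨4 * n, hC.lower x hx _ (by rw [ord_vtx_four]; linarith)⟩
  exact ⟨i, hi, fun h => by have := hi' _ h; omega⟩

lemma IsCut.mem_vtx_iff (hC : IsCut C) {g : F2} {i : ℤ} (h : At C g i) (k : ℤ) :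
    g * vtx k ∈ C ↔ k ≤ i := by
  constructor
  · intro hk
    have := hC.lt hk h.2
    rw [ord_mul_vtx_lt_iff] at this
    omega
  · intro hk
    rcases hk.eq_or_lt with rfl | hk
    · exact h.1
    · exact hC.lower _ h.1 _ ((ord_mul_vtx_lt_iff g).2 hk)

lemma IsCut.at_unique (hC : IsCut C) {g : F2} {i j : ℤ} (hi : At C g i) (hj : At C g j) :
    i = j := by
  have h1 := (hC.mem_vtx_iff hi j).1 hj.1
  have h2 := (hC.mem_vtx_iff hj i).1 hi.1
  omega

open Classical in
/-- The index of the arc at `g` containing the cut. -/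
noncomputable def idx (C : Set F2) (g : F2) : ℤ :=
  if h : ∃ i, At C g i then h.choose else 0

lemma IsCut.at_idx (hC : IsCut C) (g : F2) : At C g (idx C g) := by
  have h := hC.exists_at g
  rw [idx, dif_pos h]
  exact h.choose_spec

lemma IsCut.idx_eq (hC : IsCut C) {g : F2} {i : ℤ} (h : At C g i) : idx C g = i :=
  hC.at_unique (hC.at_idx g) h

lemma IsCut.idx_act (hC : IsCut C) (u g : F2) (j : ℤ) :
    idx (RankTwo.act u j C) (u * g) = idx C g + 4 * j := by
  refine (hC.act u j).idx_eq ?_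
  have h := hC.at_idx g
  have e : ∀ k, u * g * vtx (k + 4 * j) = u * (g * vtx k) * gc ^ j := fun k => by
    rw [vtx_add]; simp only [mul_assoc]
  rw [At, add_right_comm, e, e, mul_mem_act, mul_mem_act]
  exact h

/-- One step of the flow towards the cut. -/
noncomputable def nxt (C : Set F2) (g : F2) : F2 := g * el (lt (idx C g))

lemma IsCut.nxt_act (hC : IsCut C) (u g : F2) (j : ℤ) :
    nxt (RankTwo.act u j C) (u * g) = u * nxt C g := by
  rw [nxt, hC.idx_act, lt_add, nxt, mul_assoc]

lemma IsCut.edge (hC : IsCut C) (g : F2) (x : Letter) :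
    nxt C g = g * el x ∨ nxt C (g * el x) = g := by
  obtain ⟨k, rfl⟩ := exists_lt x
  have h := hC.at_idx g
  by_cases hk : RankTwo.lt (idx C g) = RankTwo.lt k
  · left; rw [nxt, hk]
  right
  set i := idx C g with hi
  have hk' := mt (lt_eq_iff _ _).2 hk
  obtain ⟨n, h1, h2⟩ : ∃ n, (k + 4 * n) + 4 * sh k + 1 ≤ i ∧ i + 1 ≤ (k + 4 * n) + 4 * sh k + 4 := by
    refine ⟨(i - k) / 4 - sh k, ?_⟩
    omega
  have key : At C (g * el (RankTwo.lt k)) (k + 4 * n + 2) := by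
    have e1 := el_lt_mul_vtx_add_two (k + 4 * n)
    have e2 := el_lt_mul_vtx_sub_one (k + 4 * n + 4 * 1)
    rw [lt_add, sh_add] at e1
    rw [lt_add, lt_add, sh_add, sh_add,
      show k + 4 * n + 4 * 1 - 1 = k + 4 * n + 2 + 1 by ring] at e2
    constructor
    · rw [mul_assoc, e1, hC.mem_vtx_iff h]; omega
    · rw [mul_assoc, e2, hC.mem_vtx_iff h]; omega
  rw [nxt, hC.idx_eq key, lt_add_two, lt_add, el_flip, mul_inv_cancel_right]

lemma IsCut.merge (hC : IsCut C) (g h : F2) :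
    ∃ m n, (nxt C)^[m] g = (nxt C)^[n] h := by
  obtain ⟨w, rfl⟩ : ∃ w, h = g * w := ⟨g⁻¹ * h, by simp⟩
  rw [← mk_toWord (x := w)]
  generalize w.toWord = l
  induction l generalizing g with
  | nil => exact ⟨0, 0, by simp [← FreeGroup.one_eq_mk]⟩
  | cons x l ih =>
    obtain ⟨m, n, e⟩ := ih (g * el x)
    rw [mul_assoc, ← mk_cons] at e
    rcases hC.edge g x with h | h
    · refine ⟨m + 1, n, ?_⟩
      rw [Function.iterate_succ_apply, h, e]
    · cases m with
      | zero =>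
        refine ⟨0, n + 1, ?_⟩
        rw [Function.iterate_succ_apply', ← e]
        simpa using h.symm
      | succ m =>
        refine ⟨m, n, ?_⟩
        rw [← e, Function.iterate_succ_apply, h]

/-- Elements preserving a cut up to translation commute. -/
lemma IsCut.commute (hC : IsCut C) {u p : F2} {i j : ℤ} (hu : RankTwo.act u i C = C)
    (hp : RankTwo.act p j C = C) : Commute u p := by
  have shift : ∀ {u : F2} {i : ℤ}, RankTwo.act u i C = C →
      ∃ m n, ∀ t, u * (nxt C)^[n + t] 1 = (nxt C)^[m + t] 1 := by
    intro u i hu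
    have step : ∀ n x, (nxt C)^[n] (u * x) = u * (nxt C)^[n] x := by
      intro n
      induction n with
      | zero => intro x; rfl
      | succ n ih =>
        intro x
        rw [Function.iterate_succ_apply, Function.iterate_succ_apply, ← ih]
        congr 1
        have := hC.nxt_act u x i
        rwa [hu] at this
    obtain ⟨m, n, e⟩ := hC.merge 1 (u * 1)
    refine ⟨m, n, fun t => ?_⟩
    rw [add_comm m, add_comm n, Function.iterate_add_apply, Function.iterate_add_apply _ t, e,
      step, step]
  obtain ⟨m, n, h⟩ := shift hu
  obtain ⟨m', n', h'⟩ := shift hp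
  have h1 : u * p * (nxt C)^[n + n'] 1 = (nxt C)^[m + m'] 1 := by
    rw [add_comm n, mul_assoc, h', add_comm m', h]
  have h2 : p * u * (nxt C)^[n + n'] 1 = (nxt C)^[m + m'] 1 := by
    rw [mul_assoc, h, add_comm m, h', add_comm m']
  exact mul_right_cancel (h1.trans h2.symm)

/-- The powers of `p` converge to the cut `C` up to translation. -/
def Conv (p : F2) (C : Set F2) : Prop :=
  ∃ (h : F2) (i : ℤ), ∀ x ∈ C, ∀ y ∉ C, ∃ N₀ : ℕ, ∀ N ≥ N₀,
    ord x < ord (p ^ N * h * gc ^ (i * N)) ∧ ord (p ^ N * h * gc ^ (i * N)) < ord y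

lemma pow_succ_mul_gc (p h : F2) (i : ℤ) (N : ℕ) :
    p ^ (N + 1) * h * gc ^ (i * (N + 1 : ℕ)) = p * (p ^ N * h * gc ^ (i * N)) * gc ^ i := by
  rw [Nat.cast_succ, mul_add_one, zpow_add, pow_succ']; group

lemma Conv.stab {p : F2} (h : Conv p C) : ∃ i, RankTwo.act p i C = C := by
  obtain ⟨g, i, H⟩ := h
  refine ⟨i, ?_⟩
  have : ∀ x, p * x * gc ^ i ∈ C ↔ x ∈ C := by
    intro x
    constructor
    · intro hx
      by_contra hx'
      obtain ⟨N, hN⟩ := H _ hx _ hx'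
      have h1 := (hN (N + 1) (by omega)).1
      have h2 := (hN N le_rfl).2
      rw [pow_succ_mul_gc, ord_act_lt_iff] at h1
      exact lt_asymm h1 h2
    · intro hx
      by_contra hx'
      obtain ⟨N, hN⟩ := H _ hx _ hx'
      have h1 := (hN (N + 1) (by omega)).2
      have h2 := (hN N le_rfl).1
      rw [pow_succ_mul_gc, ord_act_lt_iff] at h1
      exact lt_asymm h1 h2
  ext x
  rw [mem_act, ← this]
  group

lemma Conv.conj {p : F2} (h : Conv p C) (g : F2) : Conv (g * p * g⁻¹) (RankTwo.act g 0 C) := by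
  obtain ⟨k, i, H⟩ := h
  refine ⟨g * k, i, fun x hx y hy => ?_⟩
  obtain ⟨N₀, hN⟩ := H _ hx _ hy
  refine ⟨N₀, fun N hNN => ?_⟩
  have := hN N hNN
  rw [← ord_mul_lt_iff g, ← ord_mul_lt_iff g (y := _ * y * _)] at this
  have e : g * (p ^ N * k * gc ^ (i * N)) = (g * p * g⁻¹) ^ N * (g * k) * gc ^ (i * N) := by
    rw [conj_pow]; group
  rw [e] at this
  simpa [mul_assoc] using this

lemma head?_of_strict {y : F2} {j : ℤ} (h : ord (vtx j) < ord y) (h' : ord y < ord (vtx (j + 1))) :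
    y.toWord.head? = some (lt j) := by
  have hv : ∀ k, y ≠ vtx k := by
    rintro k rfl
    rw [compat_ord.lt_iff] at h h'
    omega
  obtain ⟨k, hk, H⟩ := exists_inArc (y := y) (vtx_zero ▸ hv 0)
  rcases H ord compat_ord with ⟨h1, h2⟩ | h1 | h1
  · have h3 := compat_ord.lt_iff.1 (h.trans h2)
    have h4 := compat_ord.lt_iff.1 (h1.trans h')
    rw [hk, show k = j by omega]
  · exact absurd h1 (hv _)
  · exact absurd h1 (hv _)

lemma Conv.idx_mod {p : F2} (hp : p ≠ 1) (hC : IsCut C) (hD : IsCut D) (h : Conv p C)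
    (h' : Conv p D) (g : F2) : lt (idx C g) = lt (idx D g) := by
  by_contra hne
  have key : ∀ {C : Set F2}, IsCut C → Conv p C → ∃ (k : F2) (N₀ : ℕ), ∀ N ≥ N₀,
      (g⁻¹ * p ^ N * k).toWord.head? = some (lt (idx C g)) := by
    intro C hC h
    obtain ⟨k, i, H⟩ := h
    obtain ⟨N₀, hN⟩ := H _ (hC.at_idx g).1 _ (hC.at_idx g).2
    refine ⟨k, N₀, fun N hNN => ?_⟩
    obtain ⟨h1, h2⟩ := hN N hNN
    rw [← lt_add _ (-(i * N))]
    apply head?_of_strict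
    · rw [vtx_add, ← ord_mul_lt_iff g, ← mul_assoc, ← ord_act_lt_iff 1 (i * N)]
      convert h1 using 2 <;> group
    · rw [add_right_comm, vtx_add, ← ord_mul_lt_iff g, ← mul_assoc g (vtx _),
        ← ord_act_lt_iff 1 (i * N)]
      convert h2 using 2 <;> group
  obtain ⟨k, N₀, hk⟩ := key hC h
  obtain ⟨k', N₀', hk'⟩ := key hD h'
  have bound : ∀ N : ℕ, (p⁻¹ ^ (N + N₀ + N₀') * g).norm ≤ k.norm + (k⁻¹ * k').norm := by
    intro N
    have h1 := hk (N + N₀ + N₀') (by omega)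
    have h2 := hk' (N + N₀ + N₀') (by omega)
    set M := N + N₀ + N₀'
    have h3 := norm_inv_mul (g⁻¹ * p ^ M * k) (g⁻¹ * p ^ M * k')
    have h4 : gp (g⁻¹ * p ^ M * k) (g⁻¹ * p ^ M * k') = 0 := by
      refine Nat.eq_zero_of_not_pos fun h => ?_
      rw [gp, lcp_pos_iff, h1, h2] at h
      exact hne (Option.some.inj h.2)
    rw [h4] at h3
    have e : (g⁻¹ * p ^ M * k)⁻¹ * (g⁻¹ * p ^ M * k') = k⁻¹ * k' := by group
    rw [e] at h3
    have e2 : p⁻¹ ^ M * g = k * (g⁻¹ * p ^ M * k)⁻¹ := by rw [inv_pow]; group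
    have h5 := FreeGroup.norm_mul_le k (g⁻¹ * p ^ M * k)⁻¹
    rw [FreeGroup.norm_inv_eq] at h5
    rw [e2]
    omega
  obtain ⟨n, -, m, -, hnm, e⟩ := Set.infinite_univ.exists_lt_map_eq_of_mapsTo
    (f := fun N : ℕ => p⁻¹ ^ (N + N₀ + N₀') * g) (t := {w : F2 | w.norm ≤ k.norm + (k⁻¹ * k').norm})
    (fun N _ => bound N) (finite_ball _)
  have e' := mul_right_cancel e
  have := IsMulTorsionFree.pow_right_injective (inv_ne_one.2 hp) e'
  omega

end Cut


section Uniqueness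
variable {C D : Set F2} {p : F2}

lemma Conv.translate (h : Conv p C) (j : ℤ) : Conv p (act 1 j C) := by
  obtain ⟨k, i, H⟩ := h
  refine ⟨k * gc ^ j, i, fun x hx y hy => ?_⟩
  obtain ⟨N₀, hN⟩ := H _ hx _ hy
  refine ⟨N₀, fun N hNN => ?_⟩
  have := hN N hNN
  rw [← ord_act_lt_iff 1 j, ← ord_act_lt_iff 1 j (y := 1⁻¹ * y * _)] at this
  have e : 1 * (p ^ N * k * gc ^ (i * N)) * gc ^ j = p ^ N * (k * gc ^ j) * gc ^ (i * N) := by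
    group
  rw [e] at this
  simpa [mul_assoc] using this

lemma IsCut.idx_nxt (hC : IsCut C) (g : F2) :
    idx C g - 1 ≤ idx C (nxt C g) + 4 * sh (idx C g) ∧
      idx C (nxt C g) + 4 * sh (idx C g) ≤ idx C g + 1 := by
  set i := idx C g with hi
  have h := hC.at_idx g
  rw [← hi] at h
  have h' := hC.at_idx (nxt C g)
  have e : ∀ k m, el (RankTwo.lt i) * vtx k = vtx (m + 4 * sh i) →
      nxt C g * vtx (k - 4 * sh i) = g * vtx m := by
    intro k m hk
    have := vtx_add m (sh i)
    rw [← hk] at this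
    rw [nxt, ← hi, show k - 4 * sh i = k + 4 * (-sh i) by ring, vtx_add, mul_assoc,
      ← mul_assoc (el _), this]
    simp
  have e1 := e _ _ (el_lt_mul_vtx_sub_one i)
  have e2 := e _ _ (el_lt_mul_vtx_add_two i)
  have h1 := (hC.mem_vtx_iff h' (i - 1 - 4 * sh i)).1 (e1 ▸ h.1)
  have h2 := mt (hC.mem_vtx_iff h' (i + 2 - 4 * sh i)).2 (e2 ▸ h.2)
  omega

lemma norm_lt_of_head? {y : F2} {x : Letter} (h : y.toWord.head? = some x) :
    ((el x)⁻¹ * y).norm < y.norm := by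
  obtain ⟨l, hl⟩ : ∃ l, y.toWord = x :: l := by
    cases hw : y.toWord with
    | nil => simp [hw] at h
    | cons z l => rw [hw] at h; exact ⟨l, by simpa using h⟩
  have e : (el x)⁻¹ * y = FreeGroup.mk l := by
    rw [← mk_toWord (x := y), hl, mk_cons, inv_mul_cancel_left]
  have h2 : y.norm = l.length + 1 := by rw [FreeGroup.norm, hl]; rfl
  have h3 : (FreeGroup.mk l).norm ≤ l.length := norm_mk_le
  rw [e]; omega

lemma Conv.subset_of_idx_eq (hp : p ≠ 1) (hC : IsCut C) (hD : IsCut D) (h : Conv p C)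
    (h' : Conv p D) {g : F2} (e : idx C g = idx D g) : C ⊆ D := by
  intro z hz
  induction hn : (g⁻¹ * z).norm using Nat.strong_induction_on generalizing g with
  | _ n ih =>
    by_contra hz'
    have h1 := hD.at_idx g
    rw [← e] at h1
    have h2 : ord (vtx (idx C g)) < ord (g⁻¹ * z) := by
      rw [← ord_mul_lt_iff g, mul_inv_cancel_left]
      exact hD.lt h1.1 hz'
    have h3 : ord (g⁻¹ * z) < ord (vtx (idx C g + 1)) := by
      rw [← ord_mul_lt_iff g, mul_inv_cancel_left]
      exact hC.lt hz (hC.at_idx g).2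
    have h4 := norm_lt_of_head? (head?_of_strict h2 h3)
    rw [← mul_assoc, ← mul_inv_rev, hn] at h4
    refine hz' (ih _ h4 (g := nxt C g) ?_ rfl)
    have m := h.idx_mod hp hC hD h' (nxt C g)
    rw [lt_eq_iff] at m
    have b1 := hC.idx_nxt g
    have b2 := hD.idx_nxt g
    rw [← e, show nxt D g = nxt C g by rw [nxt, nxt, e] ] at b2
    omega

lemma Conv.eq_translate (hp : p ≠ 1) (hC : IsCut C) (hD : IsCut D) (h : Conv p C)
    (h' : Conv p D) : ∃ j, D = act 1 j C := by
  have m := h.idx_mod hp hC hD h' 1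
  rw [lt_eq_iff] at m
  obtain ⟨j, hj⟩ : ∃ j, idx D 1 = idx C 1 + 4 * j := ⟨(idx D 1 - idx C 1) / 4, by omega⟩
  refine ⟨j, ?_⟩
  have e : idx (act 1 j C) 1 = idx D 1 := by
    have := hC.idx_act 1 1 j
    rw [mul_one] at this
    rw [this, hj]
  exact subset_antisymm (h'.subset_of_idx_eq hp hD (hC.act 1 j) (h.translate j) e.symm)
    ((h.translate j).subset_of_idx_eq hp (hC.act 1 j) hD h' e)

end Uniqueness

section Existence

lemma commute_of_commute_zpow {x y : F2} {n : ℤ} (hn : n ≠ 0) (h : Commute x (y ^ n)) :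
    Commute x y := by
  have : (x * y * x⁻¹) ^ n = y ^ n := by
    rw [conj_zpow, h.eq, mul_inv_cancel_right]
  have := zpow_left_injective hn this
  exact mul_inv_eq_iff_eq_mul.1 this

lemma exists_conv_of_monotone {p h : F2} {i : ℤ} {y : F2}
    (H : ∀ N : ℕ, ord (p ^ N * h * gc ^ (i * N)) < ord (p ^ (N + 1) * h * gc ^ (i * (N + 1 : ℕ))))
    (hy : ∀ N : ℕ, ord (p ^ N * h * gc ^ (i * N)) ≤ ord y) : ∃ C, IsCut C ∧ Conv p C := by
  have mono := strictMono_nat_of_lt_succ H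
  refine ⟨{x | ∃ N : ℕ, ord x < ord (p ^ N * h * gc ^ (i * N))}, ⟨?_, ?_, ?_⟩, h, i, ?_⟩
  · rintro x ⟨N, hN⟩ y hxy
    exact ⟨N, hxy.trans hN⟩
  · exact ⟨_, 1, H 0⟩
  · exact ⟨y, fun ⟨N, hN⟩ => (hy N).not_gt hN⟩
  · rintro x ⟨N₀, hx⟩ y hy
    refine ⟨N₀, fun N hN => ⟨hx.trans_le (mono.monotone hN), ?_⟩⟩
    exact (H N).trans_le (le_of_not_gt fun h => hy ⟨_, h⟩)

lemma exists_conv_of_antitone {p h : F2} {i : ℤ} {x : F2}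
    (H : ∀ N : ℕ, ord (p ^ (N + 1) * h * gc ^ (i * (N + 1 : ℕ))) < ord (p ^ N * h * gc ^ (i * N)))
    (hx : ∀ N : ℕ, ord x ≤ ord (p ^ N * h * gc ^ (i * N))) : ∃ C, IsCut C ∧ Conv p C := by
  have anti := strictAnti_nat_of_succ_lt (f := fun N : ℕ => ord (p ^ N * h * gc ^ (i * N))) H
  refine ⟨{x | ∀ N : ℕ, ord x < ord (p ^ N * h * gc ^ (i * N))}, ⟨?_, ?_, ?_⟩, h, i, ?_⟩
  · exact fun x hx y hxy N => hxy.trans (hx N)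
  · exact ⟨x, fun N => (hx _).trans_lt (H N)⟩
  · exact ⟨_, fun h => lt_irrefl _ (h 0)⟩
  · intro x hx y hy
    simp only [Set.mem_ofPred_eq, not_forall, not_lt] at hy
    obtain ⟨N₀, hN₀⟩ := hy
    refine ⟨N₀ + 1, fun N hN => ⟨hx N, ?_⟩⟩
    exact (anti hN).trans_le hN₀

lemma not_commute_gc (i : ℤ) : ¬ Commute ((vtx i)⁻¹ * vtx (i + 1)) gc := by
  have key : ∀ r, ¬ Commute ((vtx r)⁻¹ * vtx (r + 1)) gc → ∀ n,
      ¬ Commute ((vtx (r + 4 * n))⁻¹ * vtx (r + 4 * n + 1)) gc := by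
    intro r h n hn
    apply h
    rw [add_right_comm, vtx_add, vtx_add] at hn
    have h1 := (Commute.refl gc).zpow_left n
    have h2 := (h1.mul_left hn).mul_left h1.inv_left
    have e : gc ^ n * ((vtx r * gc ^ n)⁻¹ * (vtx (r + 1) * gc ^ n)) * (gc ^ n)⁻¹ =
        (vtx r)⁻¹ * vtx (r + 1) := by group
    rwa [e] at h2
  obtain ⟨n, rfl | rfl | rfl | rfl⟩ := int_cases_four i <;> refine key _ ?_ n <;>
  unfold Commute SemiconjBy <;> decide

lemma exists_conv_of_isCyclicallyReduced {l : List Letter} (hl : FreeGroup.IsCyclicallyReduced l)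
    (hne : l ≠ []) : ∃ C, IsCut C ∧ Conv (FreeGroup.mk l) C := by
  set r : F2 := FreeGroup.mk l with hr
  have hr1 : r ≠ 1 := by
    have : r.toWord = l := hl.isReduced.reduce_eq
    intro h
    rw [h, toWord_one] at this
    exact hne this.symm
  obtain ⟨i, hi⟩ := exists_lt (l.head hne)
  obtain ⟨j, hj, H⟩ := exists_inArc_mk l hl.isReduced i fun x hx hx' => by
    have := hl.2 x hx (l.head hne) (by simp [List.head?_eq_some_head hne])
    rw [hi, hx'] at this
    simp [Letter.flip] at this
  rw [List.head?_eq_some_head hne, Option.getD_some, hi, lt_eq_iff] at hj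
  obtain ⟨κ, rfl⟩ : ∃ κ, j = i + 4 * κ := ⟨(j - i) / 4, by omega⟩
  replace H : ∀ y, InArc ord i y → InArc ord i (r * y * gc ^ (-κ)) := by
    intro y hy
    have e : ∀ x : F2, x = 1 * (x * gc ^ κ) * gc ^ (-κ) := fun x => by group
    rcases H ord compat_ord y hy with h | h | h
    · rw [add_right_comm, vtx_add, vtx_add] at h
      left
      rw [e (vtx i), e (vtx (i + 1)), ← one_mul (r * y), ord_act_lt_iff, ord_act_lt_iff]
      exact h
    · right; left; rw [h, vtx_add]; group
    · right; right; rw [h, add_right_comm, vtx_add]; group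
  have HN : ∀ y, InArc ord i y → ∀ N : ℕ, InArc ord i (r ^ N * y * gc ^ (-κ * N)) := by
    intro y hy N
    induction N with
    | zero => simpa
    | succ N ih => rw [pow_succ_mul_gc]; exact H _ ih
  have lo : ∀ {y}, InArc ord i y → ord (vtx i) ≤ ord y := by
    have := compat_ord.lt_iff.2 (lt_add_one i)
    rintro y (h | rfl | rfl)
    exacts [h.1.le, le_rfl, this.le]
  have hi : ∀ {y}, InArc ord i y → ord y ≤ ord (vtx (i + 1)) := by
    have := compat_ord.lt_iff.2 (lt_add_one i)
    rintro y (h | rfl | rfl)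
    exacts [h.2.le, this.le, le_rfl]
  have a1 : InArc ord i (vtx i) := Or.inr (Or.inl rfl)
  have a2 : InArc ord i (vtx (i + 1)) := Or.inr (Or.inr rfl)
  by_cases f1 : r * vtx i * gc ^ (-κ) = vtx i
  · by_cases f2 : r * vtx (i + 1) * gc ^ (-κ) = vtx (i + 1)
    · exfalso
      rw [zpow_neg, mul_inv_eq_iff_eq_mul] at f1 f2
      have hκ : κ ≠ 0 := by
        rintro rfl
        rw [zpow_zero, mul_one] at f1
        exact hr1 (mul_eq_right.1 f1)
      refine not_commute_gc i (commute_of_commute_zpow hκ ?_)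
      rw [commute_iff_eq, mul_assoc, ← f2, ← mul_assoc, ← mul_assoc]
      congr 1
      rw [inv_mul_eq_iff_eq_mul, ← mul_assoc, ← f1, mul_inv_cancel_right]
    · refine exists_conv_of_antitone (h := vtx (i + 1)) (i := -κ) (x := vtx i) (fun N => ?_)
        fun N => lo (HN _ a2 N)
      induction N with
      | zero =>
        rw [pow_succ_mul_gc]
        simp only [pow_zero, one_mul, Nat.cast_zero, mul_zero, zpow_zero, mul_one]
        exact lt_of_le_of_ne (hi (H _ a2)) fun h => f2 (compat_ord.injective h)
      | succ N ih =>
        rw [pow_succ_mul_gc _ _ _ (N + 1), pow_succ_mul_gc _ _ _ N, ord_act_lt_iff,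
          ← pow_succ_mul_gc]
        exact ih
  · refine exists_conv_of_monotone (h := vtx i) (i := -κ) (y := vtx (i + 1)) (fun N => ?_)
      fun N => hi (HN _ a1 N)
    induction N with
    | zero =>
      rw [pow_succ_mul_gc]
      simp only [pow_zero, one_mul, Nat.cast_zero, mul_zero, zpow_zero, mul_one]
      exact lt_of_le_of_ne (lo (H _ a1)) fun h => f1 (compat_ord.injective h).symm
    | succ N ih =>
      rw [pow_succ_mul_gc _ _ _ (N + 1), pow_succ_mul_gc _ _ _ N, ord_act_lt_iff,
        ← pow_succ_mul_gc]
      exact ih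

lemma exists_conv {p : F2} (hp : p ≠ 1) : ∃ C, IsCut C ∧ Conv p C := by
  set l := FreeGroup.reduceCyclically p.toWord
  set g : F2 := FreeGroup.mk (reduceCyclically.conjugator p.toWord)
  have e : p = g * FreeGroup.mk l * g⁻¹ := by
    rw [inv_mk, mul_mk, mul_mk, reduceCyclically.conj_conjugator_reduceCyclically, mk_toWord]
  have hl : l ≠ [] := by
    intro h
    rw [h, ← FreeGroup.one_eq_mk] at e
    exact hp (by simpa using e)
  obtain ⟨C, hC, h⟩ := exists_conv_of_isCyclicallyReduced
    (reduceCyclically.isCyclicallyReduced isReduced_toWord) hl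
  exact ⟨_, hC.act g 0, e ▸ h.conj g⟩

end Existence


section Push
variable {f : Monoid.End F2} {φ : F2 → F2} {χ : F2 → ℤ} {ε : ℤ} {C S : Set F2} {p q b g : F2}

lemma act_eq_image (g : F2) (i : ℤ) (S : Set F2) : act g i S = (fun y => g * y * gc ^ i) '' S := by
  ext x
  constructor
  · intro hx
    exact ⟨_, hx, by group⟩
  · rintro ⟨y, hy, rfl⟩
    exact mul_mem_act.2 hy

lemma Realizes.image_act (h : Realizes f φ χ ε) (g : F2) (i : ℤ) (S : Set F2) :
    φ '' act g i S = act (f g) (χ g + ε * i) (φ '' S) := by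
  rw [act_eq_image, act_eq_image, Set.image_image, Set.image_image]
  refine Set.image_congr fun x _ => ?_
  rw [mul_assoc, h.equiv, h.gc_zpow, add_comm, zpow_add]
  group

lemma Realizes.chi_one (h : Realizes f φ χ ε) : χ 1 = 0 := by
  have := h.equiv 1 1
  rw [map_one, one_mul, one_mul] at this
  have := congrArg ord this
  rw [ord_mul_zpow] at this
  exact_mod_cast (left_eq_add.1 this)

lemma Realizes.pow (h : Realizes f φ χ ε) (hp : f p = p) (k : F2) (i : ℤ) (N : ℕ) :
    φ (p ^ N * k * gc ^ (i * N)) = p ^ N * φ k * gc ^ ((χ p + ε * i) * N) := by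
  induction N with
  | zero => simp
  | succ N ih =>
    rw [pow_succ_mul_gc, pow_succ_mul_gc, ← ih, mul_assoc, h.equiv, h.gc_zpow, hp, add_comm (χ p),
      zpow_add]
    group

lemma Realizes.injective (h : Realizes f φ χ ε) : Function.Injective φ := by
  intro x y e
  by_contra hne
  have hne' : ord x ≠ ord y := fun h => hne (compat_ord.injective h)
  rcases h.mono with ⟨-, H⟩ | ⟨-, H⟩ <;> rcases hne'.lt_or_gt with h | h <;>
  · have := H _ _ h
    rw [e] at this
    exact lt_irrefl _ this

lemma Realizes.lt_iff (h : Realizes f φ χ 1) {x y : F2} : ord (φ x) < ord (φ y) ↔ ord x < ord y := by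
  have H : ∀ x y, ord x < ord y → ord (φ x) < ord (φ y) := by
    rcases h.mono with ⟨-, H⟩ | ⟨h, -⟩
    · exact H
    · norm_num at h
  refine ⟨fun hxy => ?_, H x y⟩
  by_contra! hyx
  rcases hyx.lt_or_eq with hyx | hyx
  · exact lt_asymm hxy (H _ _ hyx)
  · rw [compat_ord.injective hyx] at hxy
    exact lt_irrefl _ hxy

lemma Realizes.lt_iff_gt (h : Realizes f φ χ (-1)) {x y : F2} :
    ord (φ x) < ord (φ y) ↔ ord y < ord x := by
  have H : ∀ x y, ord x < ord y → ord (φ y) < ord (φ x) := by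
    rcases h.mono with ⟨h, -⟩ | ⟨-, H⟩
    · norm_num at h
    · exact H
  refine ⟨fun hxy => ?_, H y x⟩
  by_contra! hyx
  rcases hyx.lt_or_eq with hyx | hyx
  · exact lt_asymm hxy (H _ _ hyx)
  · rw [compat_ord.injective hyx] at hxy
    exact lt_irrefl _ hxy

lemma Realizes.isCut_image (h : Realizes f φ χ 1) (hC : IsCut C) : IsCut (φ '' C) where
  lower := by
    rintro _ ⟨x, hx, rfl⟩ y hy
    obtain ⟨y, rfl⟩ := h.surj y
    exact ⟨y, hC.lower x hx y (h.lt_iff.1 hy), rfl⟩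
  nonempty := by
    obtain ⟨x, hx⟩ := hC.nonempty
    exact ⟨_, x, hx, rfl⟩
  proper := by
    obtain ⟨x, hx⟩ := hC.proper
    exact ⟨φ x, fun ⟨y, hy, e⟩ => hx (h.injective e ▸ hy)⟩

lemma Realizes.isCut_image_compl (h : Realizes f φ χ (-1)) (hC : IsCut C) : IsCut (φ '' Cᶜ) where
  lower := by
    rintro _ ⟨x, hx, rfl⟩ y hy
    obtain ⟨y, rfl⟩ := h.surj y
    exact ⟨y, fun hy' => hx (hC.lower y hy' x (h.lt_iff_gt.1 hy)), rfl⟩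
  nonempty := by
    obtain ⟨x, hx⟩ := hC.proper
    exact ⟨_, x, hx, rfl⟩
  proper := by
    obtain ⟨x, hx⟩ := hC.nonempty
    exact ⟨φ x, fun ⟨y, hy, e⟩ => hy (h.injective e ▸ hx)⟩

lemma Realizes.conv_image (h : Realizes f φ χ 1) (hp : f p = p) (hC : Conv p C) :
    Conv p (φ '' C) := by
  obtain ⟨k, i, H⟩ := hC
  refine ⟨φ k, χ p + 1 * i, ?_⟩
  rintro _ ⟨x, hx, rfl⟩ y hy
  obtain ⟨y, rfl⟩ := h.surj y
  obtain ⟨N₀, hN⟩ := H x hx y fun hy' => hy ⟨y, hy', rfl⟩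
  refine ⟨N₀, fun N hNN => ?_⟩
  rw [← h.pow hp, h.lt_iff, h.lt_iff]
  exact hN N hNN

lemma Realizes.conv_image_compl (h : Realizes f φ χ (-1)) (hp : f p = p) (hC : Conv p C) :
    Conv p (φ '' Cᶜ) := by
  obtain ⟨k, i, H⟩ := hC
  refine ⟨φ k, χ p + -1 * i, ?_⟩
  rintro _ ⟨x, hx, rfl⟩ y hy
  obtain ⟨y, rfl⟩ := h.surj y
  obtain ⟨N₀, hN⟩ := H y (by_contra fun hy' => hy ⟨y, hy', rfl⟩) x hx
  refine ⟨N₀, fun N hNN => ?_⟩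
  rw [← h.pow hp, h.lt_iff_gt, h.lt_iff_gt]
  exact (hN N hNN).symm

/-- An automorphism fixing `p` acts on the translates of a cut stabilized by `p`. -/
lemma Realizes.exists_push (h : Realizes f φ χ ε) (hp : f p = p) (hp1 : p ≠ 1) (hC : IsCut C)
    (hpC : Conv p C) : ∃ ψ : Set F2 → Set F2, (ε = 1 ∧ Monotone ψ ∨ ε = -1 ∧ Antitone ψ) ∧
      ∀ g i, ψ (act g i C) = act (f g) (χ g + ε * i) C := by
  rcases h.mono with ⟨rfl, -⟩ | ⟨rfl, -⟩
  · obtain ⟨j, hj⟩ := hpC.eq_translate hp1 hC (h.isCut_image hC) (h.conv_image hp hpC)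
    refine ⟨fun S => act 1 (-j) (φ '' S), Or.inl ⟨rfl, fun S T hST =>
      act_mono (Set.image_mono hST)⟩, fun g i => ?_⟩
    simp only [h.image_act, hj, act_act]
    congr 1
    · group
    · ring
  · obtain ⟨j, hj⟩ := hpC.eq_translate hp1 hC (h.isCut_image_compl hC) (h.conv_image_compl hp hpC)
    refine ⟨fun S => act 1 (-j) (φ '' Sᶜ), Or.inr ⟨rfl, fun S T hST =>
      act_mono (Set.image_mono (Set.compl_subset_compl.2 hST))⟩, fun g i => ?_⟩
    simp only [act_compl, h.image_act, hj, act_act]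
    congr 1
    · group
    · ring

lemma IsCut.subset_translate (hC : IsCut C) {n : ℤ} (hn : 0 ≤ n) : C ⊆ RankTwo.act 1 n C := by
  rcases hn.eq_or_lt with rfl | hn
  · rw [act_one_zero]
  · refine hC.subset_of_lt (hC.act 1 n) ?_
    rw [hC.cutPos_translate]
    have : (0 : ℝ) < n := by exact_mod_cast hn
    linarith

lemma IsCut.exists_subset_translate (hC : IsCut C) {D : Set F2} (hD : IsCut D) :
    ∃ n, C ⊆ RankTwo.act 1 n D := by
  obtain ⟨n, hn⟩ := exists_int_gt (cutPos C - cutPos D)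
  refine ⟨n, hC.subset_of_lt (hD.act 1 n) ?_⟩
  rw [hD.cutPos_translate]
  linarith

/-- A monotone map commuting with translations and preserving a cut fixes every cut which is
periodic up to translation. -/
lemma commute_of_monotone {ψ : Set F2 → Set F2} (hψ : Monotone ψ) (hC : IsCut C) {j : ℤ}
    (hpC : act p j C = C) (hχ : χ 1 = 0)
    (h : ∀ g i, ψ (act g i C) = act (f g) (χ g + i) C) {m : ℕ} (hm : 0 < m)
    (hb : f^[m] b = b) : Commute (b⁻¹ * f b) p := by
  have trans : ∀ n g i k, ψ^[n] (act g (i + k) C) = act 1 i (ψ^[n] (act g k C)) := by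
    intro n
    induction n with
    | zero => intro g i k; simp [act_act]
    | succ n ih =>
      intro g i k
      rw [Function.iterate_succ_apply, Function.iterate_succ_apply, h, h, ← ih, add_left_comm]
  have form : ∀ n g i, ∃ k, ψ^[n] (act g i C) = act (f^[n] g) k C := by
    intro n
    induction n with
    | zero => exact fun g i => ⟨i, rfl⟩
    | succ n ih =>
      intro g i
      rw [Function.iterate_succ_apply, h]
      exact ih _ _
  have fix : ∀ n i, ψ^[n] (act 1 i C) = act 1 i C := by
    intro n i
    refine Function.iterate_fixed ?_ n
    rw [h, map_one, hχ, zero_add]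
  set E := act b 0 C with hE
  have hEc : IsCut E := hC.act b 0
  have hcut : ∀ n, IsCut (ψ^[n] E) := fun n => by
    obtain ⟨k, hk⟩ := form n b 0
    rw [hk]; exact hC.act _ _
  obtain ⟨k, hk⟩ := form m b 0
  rw [hb] at hk
  have hper : ∀ t : ℕ, ψ^[t * m] E = act 1 (t * k) E := by
    intro t
    induction t with
    | zero => simp [act_one_zero]
    | succ t ih =>
      rw [Nat.succ_mul, Function.iterate_add_apply, hk, ← add_zero k, trans, ih, act_act]
      congr 1
      push_cast; ring
  have hk0 : k = 0 := by
    obtain ⟨n₁, h₁⟩ := hEc.exists_subset_translate hC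
    obtain ⟨n₂, h₂⟩ := hC.exists_subset_translate hEc
    rw [← act_subset_act (g := 1) (i := -n₂), act_act, neg_add_cancel, mul_one, act_one_zero] at h₂
    have up : ∀ t : ℕ, cutPos E + t * k ≤ cutPos C + n₁ := by
      intro t
      have := hψ.iterate (t * m) h₁
      rw [fix, hper] at this
      have := cutPos_mono (hEc.act _ _) (hC.act _ _) this
      rw [hEc.cutPos_translate, hC.cutPos_translate] at this
      exact_mod_cast this
    have down : ∀ t : ℕ, cutPos C - n₂ ≤ cutPos E + t * k := by
      intro t
      have := hψ.iterate (t * m) h₂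
      rw [fix, hper] at this
      have := cutPos_mono (hC.act _ _) (hEc.act _ _) this
      rw [hEc.cutPos_translate, hC.cutPos_translate] at this
      push_cast at this
      linarith
    by_contra hk0
    rcases lt_or_gt_of_ne hk0 with hk0 | hk0
    · have hk1 : (k : ℝ) ≤ -1 := by exact_mod_cast Int.le_sub_one_of_lt hk0
      obtain ⟨t, ht⟩ := exists_nat_gt (cutPos E - cutPos C + n₂)
      have := down t
      nlinarith [(Nat.cast_nonneg t : (0 : ℝ) ≤ t)]
    · have hk1 : (1 : ℝ) ≤ k := by exact_mod_cast hk0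
      obtain ⟨t, ht⟩ := exists_nat_gt (cutPos C + n₁ - cutPos E)
      have := up t
      nlinarith [(Nat.cast_nonneg t : (0 : ℝ) ≤ t)]
  have hEm : ψ^[m] E = E := by rw [hk, hk0]
  have hE1 : ψ E = E := by
    rcases hEc.total (hcut 1) with h' | h'
    · refine subset_antisymm ?_ h'
      have := hψ.monotone_iterate_of_le_map h' (show 1 ≤ m from hm)
      exact this.trans_eq hEm
    · refine subset_antisymm h' ?_
      have := hψ.antitone_iterate_of_map_le h' (show 1 ≤ m from hm)
      exact hEm.symm.trans_le this
  rw [hE, h, eq_comm, act_eq_comm, act_act] at hE1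
  exact hC.commute hE1.symm hpC

/-- Fixed cuts of an antitone map. -/
lemma commute_of_antitone {ψ : Set F2 → Set F2} (hψ : Antitone ψ) (hC : IsCut C) {j : ℤ}
    (hpC : act p j C = C) (hχ : χ 1 = 0)
    (h : ∀ g i, ψ (act g i C) = act (f g) (χ g - i) C) (hq : f q = q) : Commute q p := by
  by_contra hne
  have ex : ∀ g, f g = g → ¬ Commute g p → ∃ i, ψ (act g i C) = act g (i - 1) C := by
    intro g hg hgp
    obtain ⟨i, hi, hi'⟩ := Int.exists_least_of_bdd (P := fun i => C ⊆ act g i C) (by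
      obtain ⟨n, hn⟩ := exists_int_lt (cutPos C - cutPos (act g 0 C))
      refine ⟨n, fun z hz => ?_⟩
      have := cutPos_mono hC (hC.act g z) hz
      have e : act g z C = act 1 z (act g 0 C) := by rw [act_act, one_mul, add_zero]
      rw [e, (hC.act g 0).cutPos_translate] at this
      have : (n : ℝ) < z := by linarith
      exact_mod_cast this.le) (by
      obtain ⟨n, hn⟩ := hC.exists_subset_translate (hC.act g 0)
      rw [act_act, one_mul, add_zero] at hn
      exact ⟨n, hn⟩)
    have hi2 : act g i C ⊆ act 1 1 C := by
      have : ¬ C ⊆ act g (i - 1) C := fun h => by have := hi' _ h; omega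
      have := act_mono (g := 1) (i := 1) ((hC.total (hC.act g (i - 1))).resolve_left this)
      rwa [act_act, one_mul, add_sub_cancel] at this
    have uniq : ∀ i i', C ⊆ act g i C → act g i' C ⊆ act 1 1 C → i' ≤ i := by
      intro i i' h1 h2
      by_contra! hlt
      have h3 := act_mono (g := 1) (i := 1) h1
      rw [act_act, one_mul] at h3
      have h4 := act_mono (g := g) (i := 1 + i) (hC.subset_translate (n := i' - (1 + i)) (by omega))
      rw [act_act, mul_one, add_sub_cancel] at h4
      have e := subset_antisymm h3 (h4.trans h2)
      rw [act_eq_comm, act_act] at e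
      refine hgp (hC.commute (i := i) ?_ hpC)
      convert e.symm using 2
      · group
      · ring
    have h1 := hψ hi
    have h2 := hψ hi2
    have e0 := h 1 0
    have e1 := h 1 1
    rw [map_one, hχ, sub_zero, act_one_zero] at e0
    rw [map_one, hχ] at e1
    rw [e0, h, hg] at h1
    rw [e1, h g, hg] at h2
    have h3 := act_mono (g := 1) (i := 1) h1
    have h4 := act_mono (g := 1) (i := 1) h2
    rw [act_act, one_mul] at h3 h4
    rw [act_act, one_mul, zero_sub, add_neg_cancel, act_one_zero] at h4
    have u1 := uniq _ _ hi h3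
    have u2 := uniq _ _ h4 hi2
    refine ⟨i, ?_⟩
    rw [h, hg]
    congr 1
    omega
  obtain ⟨i, hi⟩ := ex q hq hne
  have hq2 : ¬ Commute (q * q) p := by
    intro hc
    rw [← zpow_two] at hc
    exact hne (commute_of_commute_zpow two_ne_zero hc.symm).symm
  obtain ⟨i', hi'⟩ := ex (q * q) (by rw [map_mul, hq]) hq2
  have e : act q i C = act (q * q) i' C := by
    have key : ∀ {g g' i i'}, ψ (act g i C) = act g (i - 1) C → ψ (act g' i' C) = act g' (i' - 1) C →
        act g i C ⊆ act g' i' C → act g i C = act g' i' C := by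
      intro g g' i i' h h' hs
      refine subset_antisymm hs ?_
      have := hψ hs
      rw [h, h'] at this
      have := act_mono (g := 1) (i := 1) this
      simpa only [act_act, one_mul, add_sub_cancel] using this
    rcases (hC.act q i).total (hC.act (q * q) i') with h' | h'
    · exact key hi hi' h'
    · exact (key hi' hi h').symm
  rw [act_eq_comm, act_act, inv_mul_cancel_left] at e
  exact hne (hC.commute e.symm hpC)

end Push

lemma commute_trans {u p w : F2} (hu : u ≠ 1) (h : Commute u p) (h' : Commute u w) :
    Commute p w := by
  obtain ⟨s, i, j, rfl, rfl⟩ := exists_zpow_of_commute h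
  have hi : i ≠ 0 := by rintro rfl; exact hu (zpow_zero s)
  exact ((commute_of_commute_zpow hi h'.symm).zpow_right j).symm

/-- An automorphism of the free group of rank two fixing two noncommuting elements has no
nontrivial periodic points. -/
theorem fixed_of_periodic {f : Monoid.End F2} (hf : f ∈ nielsen) {p q b : F2}
    (h : ¬ Commute p q) (hp : f p = p) (hq : f q = q) {m : ℕ} (hm : 0 < m) (hb : f^[m] b = b) :
    f b = b := by
  have hp1 : p ≠ 1 := by rintro rfl; exact h (Commute.one_left q)
  obtain ⟨C, hC, hpC⟩ := exists_conv hp1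
  obtain ⟨φ, χ, ε, hr⟩ := exists_realizes hf
  obtain ⟨j, hj⟩ := hpC.stab
  obtain ⟨ψ, ⟨rfl, hψ⟩ | ⟨rfl, hψ⟩, H⟩ := hr.exists_push hp hp1 hC hpC
  · simp only [one_mul] at H
    have key : ∀ b, f^[m] b = b → Commute (b⁻¹ * f b) p := fun b hb =>
      commute_of_monotone hψ hC hj hr.chi_one H hm hb
    have h1 := key b hb
    have h2 := key (b * q) (by rw [iterate_map_mul, hb, Function.iterate_fixed hq])
    have h3 : Commute (b⁻¹ * f b) (q * p * q⁻¹) := by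
      have := (Commute.conj_iff q).2 h2
      rw [map_mul, hq] at this
      have e : q * ((b * q)⁻¹ * (f b * q)) * q⁻¹ = b⁻¹ * f b := by group
      rwa [e] at this
    by_contra hne
    have h4 := commute_trans (fun e => hne (inv_mul_eq_one.1 e).symm) h1 h3
    have h5 : Commute ga (gb * ga * gb⁻¹) := by
      apply pairEnd_injective h
      simpa only [map_mul, map_inv, pairEnd_ga, pairEnd_gb] using h4.eq
    revert h5
    unfold Commute SemiconjBy
    decide
  · simp only [neg_one_mul, ← sub_eq_add_neg] at H
    exact absurd (commute_of_antitone hψ hC hj hr.chi_one H hq).symm h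


section Definability
variable {G : Type*} [Group G]

/-- A group isomorphism as an isomorphism of structures for the language of groups. -/
def structureEquiv (σ : G ≃* G) : grpLang.Equiv G G where
  toEquiv := σ.toEquiv
  map_fun' {_} f x := by
    cases f
    · exact map_one σ
    · exact map_inv σ (x 0)
    · exact map_mul σ (x 0) (x 1)
  map_rel' r := r.elim

lemma exists_term_realize {β : Type*} (w : FreeGroup β) :
    ∃ t : grpLang.Term β, ∀ x : β → G, t.realize x = FreeGroup.lift x w := by
  have hinv : ∀ w : FreeGroup β, (∃ t : grpLang.Term β, ∀ x : β → G,
      t.realize x = FreeGroup.lift x w) → ∃ t : grpLang.Term β, ∀ x : β → G,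
      t.realize x = FreeGroup.lift x w⁻¹ := by
    rintro w ⟨t, ht⟩
    refine ⟨.func GrpFunc.inv fun _ => t, fun x => ?_⟩
    rw [map_inv, ← ht]
    rfl
  induction w using FreeGroup.induction_on with
  | C1 => exact ⟨.func GrpFunc.one Fin.elim0, fun x => by rw [map_one]; rfl⟩
  | of i => exact ⟨.var i, fun x => by simp⟩
  | inv_of i h => exact hinv _ h
  | mul u v hu hv =>
    obtain ⟨s, hs⟩ := hu
    obtain ⟨t, ht⟩ := hv
    refine ⟨.func GrpFunc.mul ![s, t], fun x => ?_⟩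
    rw [map_mul, ← hs, ← ht]
    rfl

lemma mem_dcl_of_words {A : Set G} {n : ℕ} {ι : Type*} [Finite ι] (a : ι → A)
    (w : ι → FreeGroup (Fin n)) (v : FreeGroup (Fin n)) (b : G)
    (H : ∀ c, (∃ x : Fin n → G, (∀ i, FreeGroup.lift x (w i) = a i) ∧ FreeGroup.lift x v = c) ↔
      c = b) : b ∈ dcl A := by
  choose t ht using fun w : FreeGroup (Fin n) => exists_term_realize (G := G) w
  let φ : grpLang.Formula ((A ⊕ Fin 1) ⊕ Fin n) :=
    Language.Formula.iInf (fun i => ((t (w i)).relabel Sum.inr).equal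
      (Language.Term.var (Sum.inl (Sum.inl (a i))))) ⊓
    ((t v).relabel Sum.inr).equal (Language.Term.var (Sum.inl (Sum.inr 0)))
  refine ⟨φ.iExs (Fin n), ?_⟩
  ext c
  rw [Set.mem_ofPred_eq, Language.Formula.realize_iExs, Set.mem_singleton_iff, ← H c]
  refine exists_congr fun x => ?_
  simp [φ, Language.Formula.realize_iInf, Language.Term.realize_relabel, Function.comp_def, ht]

lemma dcl_subset_acl (A : Set G) : dcl A ⊆ acl A := by
  rintro b ⟨φ, hφ⟩
  refine ⟨φ, by rw [hφ]; exact Set.finite_singleton b, ?_⟩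
  have : b ∈ ({b} : Set G) := rfl
  rwa [← hφ] at this

lemma exists_finite_invariant_of_mem_acl {A : Set G} {b : G} (hb : b ∈ acl A) :
    ∃ (X : Set G) (A₀ : Set G), X.Finite ∧ b ∈ X ∧ A₀.Finite ∧ A₀ ⊆ A ∧
      ∀ σ : G ≃* G, (∀ a ∈ A₀, σ a = a) → ∀ x ∈ X, σ x ∈ X := by
  classical
  obtain ⟨φ, hfin, hφ⟩ := hb
  refine ⟨_, {g | ∃ a : A, Sum.inl a ∈ φ.freeVarFinset ∧ a.1 = g}, hfin, hφ, ?_, ?_, ?_⟩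
  · exact ((φ.freeVarFinset.finite_toSet.preimage Sum.inl_injective.injOn).image Subtype.val)
  · rintro _ ⟨a, -, rfl⟩
    exact a.2
  · intro σ hσ x hx
    rw [Set.mem_ofPred_eq, Language.Formula.Realize,
      ← Language.BoundedFormula.realize_restrictFreeVar (f := id)
        (v := fun y => Sum.elim Subtype.val (fun _ => σ x) y.1) _ (fun _ => rfl)]
    rw [Set.mem_ofPred_eq, ← Language.StrongHomClass.realize_formula (structureEquiv σ),
      Language.Formula.Realize,
      ← Language.BoundedFormula.realize_restrictFreeVar (f := id)
        (v := fun y => Sum.elim Subtype.val (fun _ => σ x) y.1)] at hx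
    · exact hx
    · rintro ⟨a | i, ha⟩
      · exact (hσ a ⟨a, ha, rfl⟩).symm
      · rfl

end Definability

section Main
variable {F : Type*} [Group F]

lemma mem_dcl_of_commute (e : F ≃* F2) {A : Set F} {a b : F} (ha : a ∈ A) (ha1 : a ≠ 1)
    (h : Commute (e a) (e b)) : b ∈ dcl A := by
  obtain ⟨s, i, j, hi, hj⟩ := exists_zpow_of_commute h
  have hi0 : i ≠ 0 := by
    rintro rfl
    exact ha1 (e.injective (by simpa using hi))
  have key : ∀ x : Fin 1 → F, x 0 ^ i = a ↔ e (x 0) = s := fun x => by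
    rw [← e.injective.eq_iff, map_zpow, hi]
    exact (zpow_left_injective hi0).eq_iff
  refine mem_dcl_of_words (n := 1) (ι := Unit) (fun _ => ⟨a, ha⟩) (fun _ => of 0 ^ i)
    (of 0 ^ j) b fun c => ?_
  simp only [map_zpow, lift_apply_of, forall_const, key]
  constructor
  · rintro ⟨x, hx, rfl⟩
    apply e.injective
    rw [map_zpow, hx, hj]
  · rintro rfl
    refine ⟨fun _ => e.symm s, by simp, e.injective ?_⟩
    simp [hj]

lemma commute_of_mem_acl (e : F ≃* F2) {A : Set F} {a b : F} (ha : ∀ c ∈ A, Commute a c)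
    (hb : b ∈ acl A) : Commute (e a) (e b) := by
  obtain ⟨X, A₀, hX, hbX, -, hA₀, hinv⟩ := exists_finite_invariant_of_mem_acl hb
  have hmaps : ∀ n : ℕ, a ^ n * b * (a ^ n)⁻¹ ∈ X := fun n => by
    refine hinv (MulAut.conj (a ^ n)) (fun c hc => ?_) b hbX
    rw [MulAut.conj_apply, ((ha c (hA₀ hc)).pow_left n).eq, mul_inv_cancel_right]
  obtain ⟨m, n, hmn, h⟩ := hX.exists_lt_map_eq_of_forall_mem hmaps
  have hE : e a ^ m * e b * (e a ^ m)⁻¹ = e a ^ n * e b * (e a ^ n)⁻¹ := by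
    simpa only [map_mul, map_inv, map_pow] using congrArg e h
  have hc : Commute (e b) (e a ^ (-(n : ℤ) + m)) := by
    rw [zpow_add, zpow_neg, zpow_natCast, zpow_natCast]
    calc e b * ((e a ^ n)⁻¹ * e a ^ m)
        = (e a ^ n)⁻¹ * (e a ^ n * e b * (e a ^ n)⁻¹) * e a ^ m := by group
      _ = (e a ^ n)⁻¹ * e a ^ m * e b := by rw [← hE]; group
  exact (commute_of_commute_zpow (by omega) hc).symm

lemma mem_dcl_of_not_commute (e : F ≃* F2) {A : Set F} {p q b : F} (hp : p ∈ A) (hq : q ∈ A)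
    (h : ¬ Commute (e p) (e q)) (hb : b ∈ acl A) : b ∈ dcl A := by
  obtain ⟨X, A₀, hX, hbX, hA₀, hA₀A, hinv⟩ := exists_finite_invariant_of_mem_acl hb
  let A₁ : Set F := insert p (insert q A₀)
  have hA₁ : A₁ ⊆ A := Set.insert_subset hp (Set.insert_subset hq hA₀A)
  have : Finite A₁ := ((hA₀.insert q).insert p).to_subtype
  refine mem_dcl_of_words (G := F) (n := 2) (fun i : A₁ => ⟨i, hA₁ i.2⟩) (fun i => e i) (e b) b
    fun c => ⟨?_, ?_⟩
  · rintro ⟨x, hx, rfl⟩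
    let f : Monoid.End F2 := e.toMonoidHom.comp (lift x)
    have hf : ∀ c, f c = e (lift x c) := fun _ => rfl
    have hfA : ∀ c ∈ A₁, f (e c) = e c := fun c hc => congrArg e (hx ⟨c, hc⟩)
    have hfp := hfA p (Set.mem_insert _ _)
    have hfq := hfA q (Set.mem_insert_of_mem _ (Set.mem_insert _ _))
    have hfn := mem_nielsen_of_fix h hfp hfq
    have hbij := bijective_of_mem_nielsen hfn
    let σ : F ≃* F := (e.trans (MulEquiv.ofBijective f hbij)).trans e.symm
    have hσ : ∀ c, e (σ c) = f (e c) := fun c => e.apply_symm_apply _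
    have hσX : Set.MapsTo σ X X := hinv σ fun c hc => e.injective <| by
      rw [hσ, hfA c (Set.mem_insert_of_mem _ (Set.mem_insert_of_mem _ hc))]
    have hiter : ∀ n, e (σ^[n] b) = f^[n] (e b) := fun n =>
      (Function.Semiconj.iterate_right (f := e) hσ n) b
    obtain ⟨m, n, hmn, hmn'⟩ :=
      hX.exists_lt_map_eq_of_forall_mem (f := fun n => σ^[n] b) fun n => hσX.iterate n hbX
    have hper : f^[n - m] (e b) = e b := by
      apply hbij.injective.iterate m
      rw [← Function.iterate_add_apply, Nat.add_sub_cancel' hmn.le, ← hiter, ← hiter]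
      exact congrArg e hmn'.symm
    exact e.injective (fixed_of_periodic hfn h hfp hfq (Nat.sub_pos_of_lt hmn) hper)
  · rintro rfl
    have hid : ∀ w : F2, lift (fun i => e.symm (of i)) w = e.symm w := fun w =>
      DFunLike.congr_fun (FreeGroup.ext_hom _ _ (fun i => by simp) :
        lift (fun i => e.symm (of i)) = e.symm.toMonoidHom) w
    exact ⟨fun i => e.symm (of i), fun i => by simp [hid], by simp [hid]⟩

end Main

end RankTwo

/-- Let `F` be a free group of rank 2 and `A` any nontrivial subgroup
of `F`. Then `acl(A) = dcl(A)`. -/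
theorem acl_eq_dcl_rank_two {F : Type*} [Group F] (hF : Nonempty (F ≃* FreeGroup (Fin 2)))
    (A : Subgroup F) (hA : A ≠ ⊥) :
    acl (A : Set F) = dcl (A : Set F) := by
  obtain ⟨e⟩ := hF
  refine Set.Subset.antisymm (fun b hb => ?_) (RankTwo.dcl_subset_acl _)
  by_cases hab : ∀ p ∈ A, ∀ q ∈ A, Commute p q
  · obtain ⟨a, ha, ha1⟩ := A.bot_or_exists_ne_one.resolve_left hA
    exact RankTwo.mem_dcl_of_commute e ha ha1 (RankTwo.commute_of_mem_acl e (hab a ha) hb)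
  · push Not at hab
    obtain ⟨p, hp, q, hq, hpq⟩ := hab
    exact RankTwo.mem_dcl_of_not_commute e hp hq
      (fun h => hpq (by simpa using h.map e.symm)) hb
end

section
/- Let F be a free group of finite rank and A a nonabelian subgroup of F. Suppose F = F₁ ∗ F₂ is an internal free product decomposition with A ≤ F₁ and F₁ freely A-indecomposable. Then racl_F(A) = racl_{F₁}(A). -/
open FirstOrder Filter

universe u

section InternalFreeProductLemmas

variable {G : Type*} [Group G] {H K : Subgroup G}

theorem InternalFreeProduct.exists_lift (h : InternalFreeProduct H K) {P : Type*} [Group P]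
    (α : H →* P) (β : K →* P) :
    ∃ φ : G →* P, (∀ x : H, φ x = α x) ∧ ∀ y : K, φ y = β y := by
  let e := MulEquiv.ofBijective (Monoid.Coprod.lift H.subtype K.subtype) h
  have hl (x : H) : e.symm x = Monoid.Coprod.inl x := by
    rw [MulEquiv.symm_apply_eq]
    exact (Monoid.Coprod.lift_apply_inl H.subtype K.subtype x).symm
  have hr (y : K) : e.symm y = Monoid.Coprod.inr y := by
    rw [MulEquiv.symm_apply_eq]
    exact (Monoid.Coprod.lift_apply_inr H.subtype K.subtype y).symm
  exact ⟨(Monoid.Coprod.lift α β).comp e.symm.toMonoidHom, by simp [hl], by simp [hr]⟩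

theorem InternalFreeProduct.hom_ext (h : InternalFreeProduct H K) {P : Type*} [Group P]
    {φ ψ : G →* P} (hH : ∀ x ∈ H, φ x = ψ x) (hK : ∀ y ∈ K, φ y = ψ y) : φ = ψ := by
  have : φ.comp (Monoid.Coprod.lift H.subtype K.subtype) =
      ψ.comp (Monoid.Coprod.lift H.subtype K.subtype) := by
    ext x <;> simp [hH, hK]
  ext g
  obtain ⟨z, rfl⟩ := h.2 g
  exact DFunLike.congr_fun this z

theorem InternalFreeProduct.sup_eq_top (h : InternalFreeProduct H K) : H ⊔ K = ⊤ := by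
  rw [← MonoidHom.range_eq_top.2 h.2, Monoid.Coprod.range_lift]
  simp

/-- An automorphism of the factor `H` extends to `H ∗ K`, acting on `K` by conjugation by a
prescribed element of `H`. -/
theorem InternalFreeProduct.exists_mulEquiv (h : InternalFreeProduct H K) (α : H ≃* H) (b : H) :
    ∃ f : G ≃* G, (∀ x : H, f x = α x) ∧ ∀ y ∈ K, f y = b * y * (b : G)⁻¹ := by
  obtain ⟨φ, hφ, hφ'⟩ := h.exists_lift (H.subtype.comp α.toMonoidHom)
    ((MulAut.conj (b : G)).toMonoidHom.comp K.subtype)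
  obtain ⟨ψ, hψ, hψ'⟩ := h.exists_lift (H.subtype.comp α.symm.toMonoidHom)
    ((MulAut.conj (α.symm b : G)⁻¹).toMonoidHom.comp K.subtype)
  replace hφ' : ∀ y ∈ K, φ y = b * y * (b : G)⁻¹ := fun y hy => by simpa using hφ' ⟨y, hy⟩
  replace hψ' : ∀ y ∈ K, ψ y = (α.symm b : G)⁻¹ * y * (α.symm b : G) :=
    fun y hy => by simpa using hψ' ⟨y, hy⟩
  simp only [MonoidHom.comp_apply, MulEquiv.toMonoidHom_eq_coe, MonoidHom.coe_coe,
    Subgroup.subtype_apply] at hφ hψ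
  refine ⟨φ.toMulEquiv ψ ?_ ?_, hφ, hφ'⟩
  · refine h.hom_ext (fun x hx => ?_) fun y hy => ?_
    · have := hφ ⟨x, hx⟩
      simp only at this
      simp [this, hψ]
    · simp [hφ' y hy, hψ' y hy, hψ, mul_assoc]
  · refine h.hom_ext (fun x hx => ?_) fun y hy => ?_
    · have := hψ ⟨x, hx⟩
      simp only at this
      simp [this, hφ]
    · simp [hφ' y hy, hψ' y hy, hφ, mul_assoc]

end InternalFreeProductLemmas

namespace Monoid.CoprodI

/-- The elements of a free product whose reduced word starts in the factor `i`. -/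
def startsIn {ι : Type*} (M : ι → Type*) [∀ i, Monoid (M i)] (i : ι) : Set (CoprodI M) :=
  {g | ∃ w : Word M, w.prod = g ∧ w.fstIdx = some i}

section StartsIn

variable {ι : Type*} {M : ι → Type*} [∀ i, Monoid (M i)]

theorem fstIdx_eq_of_prod_mem_startsIn {i : ι} {w : Word M} (h : w.prod ∈ startsIn M i) :
    w.fstIdx = some i := by
  classical
  obtain ⟨v, hv, hi⟩ := h
  rwa [Word.equiv.symm.injective hv] at hi

theorem eq_of_mem_startsIn {i j : ι} {g : CoprodI M} (hi : g ∈ startsIn M i)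
    (hj : g ∈ startsIn M j) : i = j := by
  obtain ⟨w, rfl, hw⟩ := hi
  rw [fstIdx_eq_of_prod_mem_startsIn hj] at hw
  exact (Option.some.inj hw).symm

theorem of_mem_startsIn {i : ι} {m : M i} (hm : m ≠ 1) : of m ∈ startsIn M i := by
  have h : (Word.empty : Word M).fstIdx ≠ some i := nofun
  exact ⟨Word.cons m Word.empty h hm, by rw [Word.prod_cons, Word.prod_empty, mul_one],
    Word.fstIdx_cons m Word.empty h hm⟩

theorem of_mul_mem_startsIn {i j : ι} (hij : j ≠ i) {m : M i} (hm : m ≠ 1) {g : CoprodI M}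
    (hg : g ∈ startsIn M j) : of m * g ∈ startsIn M i := by
  obtain ⟨w, rfl, hw⟩ := hg
  exact ⟨Word.cons m w (by simpa [hw] using hij) hm, by simp [Word.prod_cons], by simp⟩

end StartsIn

variable {M : Bool → Type*} [∀ i, Group (M i)]

/-- Twisting one factor of a free product by conjugation by a nontrivial element `b` of the other
factor fixes only the elements of the factor of `b`. -/
theorem mem_range_of_apply_eq {b : M false} (hb : b ≠ 1) {φ : CoprodI M →* CoprodI M}
    (hφ : ∀ x : M false, φ (of x) = of x)
    (hφ' : ∀ y : M true, φ (of y) = of b * of y * (of b)⁻¹)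
    {g : CoprodI M} (hg : φ g = g) : g ∈ (of : M false →* CoprodI M).range := by
  classical
  have key (w : Word M) : ∃ (x : M false) (u : CoprodI M), w.prod = of x * u ∧
      (w.fstIdx ≠ some false → x = 1) ∧
      (u = 1 ∨ u ∈ startsIn M true ∧ (of b)⁻¹ * φ u ∈ startsIn M true) := by
    induction w using Word.consRecOn with
    | empty => exact ⟨1, 1, by simp⟩
    | cons i m w h1 h2 ih =>
      obtain ⟨x, u, hw, hx, hu⟩ := ih
      cases i with
      | false =>
        refine ⟨m, u, ?_, by simp, hu⟩
        rw [Word.prod_cons, hw, hx h1, map_one, one_mul]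
      | true =>
        refine ⟨1, of m * w.prod, by simp [Word.prod_cons], by simp,
          Or.inr ⟨⟨Word.cons m w h1 h2, by simp [Word.prod_cons], by simp⟩, ?_⟩⟩
        have e : (of b)⁻¹ * φ (of m * w.prod) = of m * (of (b⁻¹ * x) * φ u) := by
          simp [hw, hφ, hφ', mul_assoc]
        rw [e]
        rcases hu with rfl | ⟨hu, hu'⟩
        · by_cases hbx : b⁻¹ * x = 1
          · simpa [hbx] using of_mem_startsIn h2
          · simpa using of_mul_mem_startsIn (by simp) h2 (of_mem_startsIn hbx)
        · have hx1 : x ≠ 1 := by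
            rintro rfl
            refine h1 (fstIdx_eq_of_prod_mem_startsIn ?_)
            simpa [hw] using hu
          have e' : of (b⁻¹ * x) * φ u = of (b⁻¹ * x * b) * ((of b)⁻¹ * φ u) := by
            simp [mul_assoc]
          rw [e']
          refine of_mul_mem_startsIn (j := false) (by simp) h2
            (of_mul_mem_startsIn (j := true) (by simp) ?_ hu')
          intro h
          apply hx1
          have := congrArg (fun z => b * z * b⁻¹) h
          simpa [mul_assoc] using this
  obtain ⟨x, u, hgu, -, hu⟩ := key (Word.equiv g)
  rw [show (Word.equiv g).prod = g from Word.equiv.symm_apply_apply g] at hgu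
  rcases hu with rfl | ⟨hu, hu'⟩
  · exact ⟨x, by simp [hgu]⟩
  · exfalso
    have hfix : φ u = u := by simpa [hgu, hφ] using hg
    rw [hfix, ← map_inv] at hu'
    have := of_mul_mem_startsIn (M := M) (i := false) (by simp) (inv_ne_one.2 hb) hu
    simpa using eq_of_mem_startsIn this hu'

end Monoid.CoprodI

section FixedElements

variable {G : Type*} [Group G] {H K : Subgroup G}

theorem InternalFreeProduct.mem_of_apply_eq (h : InternalFreeProduct H K) {b : G} (hbH : b ∈ H)
    (hb : b ≠ 1) {f : G →* G} (hf : ∀ x ∈ H, f x = x) (hf' : ∀ y ∈ K, f y = b * y * b⁻¹)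
    {g : G} (hg : f g = g) : g ∈ H := by
  let S : Bool → Subgroup G := fun i => cond i K H
  let M : Bool → Type _ := fun i => S i
  let : ∀ i, Group (M i) := fun i => inferInstanceAs (Group (S i))
  let p : Monoid.CoprodI M →* G := Monoid.CoprodI.lift fun i => (S i).subtype
  obtain ⟨j, hj, hj'⟩ := h.exists_lift (Monoid.CoprodI.of (M := M) (i := false))
    (Monoid.CoprodI.of (M := M) (i := true))
  have hpj (z : G) : p (j z) = z := by
    refine DFunLike.congr_fun (h.hom_ext (φ := p.comp j) (ψ := MonoidHom.id G)
      (fun x hx => ?_) fun y hy => ?_) z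
    · exact (congrArg p (hj ⟨x, hx⟩)).trans (Monoid.CoprodI.lift_of _ _)
    · exact (congrArg p (hj' ⟨y, hy⟩)).trans (Monoid.CoprodI.lift_of _ _)
  have hp (x : M false) : p (Monoid.CoprodI.of x) = (x : S false).1 := Monoid.CoprodI.lift_of _ _
  have hp' (x : M true) : p (Monoid.CoprodI.of x) = (x : S true).1 := Monoid.CoprodI.lift_of _ _
  have hb1 : (⟨b, hbH⟩ : M false) ≠ 1 := fun h => hb (congrArg Subtype.val h)
  have hmem := Monoid.CoprodI.mem_range_of_apply_eq (M := M) hb1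
    (φ := (j.comp f).comp p) (fun x => ?_) (fun y => ?_) (g := j g) ?_
  · obtain ⟨x, hx⟩ := hmem
    rw [← hpj g, ← hx, hp]
    exact x.2
  · simp only [MonoidHom.comp_apply, hp]
    rw [hf _ x.2]
    exact hj x
  · simp only [MonoidHom.comp_apply, hp']
    rw [hf' _ y.2, map_mul, map_mul, map_inv]
    have e1 : j b = Monoid.CoprodI.of (M := M) (i := false) ⟨b, hbH⟩ := hj ⟨b, hbH⟩
    rw [e1, show j (y : S true).1 = _ from hj' y]
  · simp [hpj, hg]

end FixedElements

section Cocycle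

variable {F : Type*} [Group F] {Q : Type*} [MulAction F Q] {N : Type*} [Group N]

/-- If every map on the generators `e` extends to a homomorphism from `F` to `Equiv.Perm (Q × N)`,
then every map `ι → Q → N` extends to an `N`-valued cocycle on the action of `F` on `Q`. -/
theorem exists_cocycle {ι : Type*} {e : ι → F} (hgen : Subgroup.closure (Set.range e) = ⊤)
    (hlift : ∀ f : ι → Equiv.Perm (Q × N), ∃ φ : F →* Equiv.Perm (Q × N), ∀ i, φ (e i) = f i)
    (Φ : ι → Q → N) :
    ∃ Ψ : F → Q → N, (∀ f g q, Ψ (f * g) q = Ψ f (g • q) * Ψ g q) ∧ ∀ i q, Ψ (e i) q = Φ i q := by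
  obtain ⟨ρ, hρ⟩ := hlift fun i =>
    { toFun := fun p => (e i • p.1, Φ i p.1 * p.2)
      invFun := fun p => ((e i)⁻¹ • p.1, (Φ i ((e i)⁻¹ • p.1))⁻¹ * p.2)
      left_inv := fun p => by simp
      right_inv := fun p => by simp }
  have key (f : F) : ∀ p, ρ f p = (f • p.1, (ρ f (p.1, 1)).2 * p.2) := by
    have hf : f ∈ Subgroup.closure (Set.range e) := hgen ▸ Subgroup.mem_top f
    induction hf using Subgroup.closure_induction with
    | mem x hx =>
      obtain ⟨i, rfl⟩ := hx
      simp [hρ]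
    | one => simp
    | mul x y _ _ hx hy =>
      intro p
      rw [map_mul, Equiv.Perm.mul_apply, Equiv.Perm.mul_apply, hy p, hy (p.1, 1), hx, hx (_, _ * 1)]
      simp [mul_smul, mul_assoc]
    | inv x _ hx =>
      intro p
      rw [map_inv, Equiv.Perm.inv_eq_iff_eq, hx]
      have h1 := hx (ρ x⁻¹ (p.1, 1))
      rw [← Equiv.Perm.mul_apply, ← map_mul, mul_inv_cancel, map_one, Equiv.Perm.one_apply,
        Prod.mk.injEq, map_inv] at h1
      have h2 : ((ρ x)⁻¹ (p.1, 1)).1 = x⁻¹ • p.1 := eq_inv_smul_iff.2 h1.1.symm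
      rw [h2] at h1
      ext
      · simp
      · change p.2 = (ρ x (x⁻¹ • p.1, 1)).2 * (((ρ x)⁻¹ (p.1, 1)).2 * p.2)
        rw [← mul_assoc, ← h1.2, one_mul]
  refine ⟨fun f q => (ρ f (q, 1)).2, fun f g q => ?_, fun i q => by simp [hρ]⟩
  simp only [map_mul, Equiv.Perm.mul_apply]
  rw [key g (q, 1), key f]

end Cocycle

section FreeFactor

variable {F : Type*} [Group F]

/-- A vertex-wise choice of paths from `q₀`: points of the `H`-orbit of `q₀` are reached by elements
of `H`, and any other point is reached through a previous point followed by a generator. -/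
theorem exists_transversal {Q ι : Type*} [MulAction F Q] [MulAction.IsPretransitive F Q]
    {e : ι → F} (hgen : Subgroup.closure (Set.range e) = ⊤) (H : Subgroup F) (q₀ : Q) :
    ∃ t : Q → F, t q₀ = 1 ∧ (∀ q, t q • q₀ = q) ∧ (∀ q ∈ MulAction.orbit H q₀, t q ∈ H) ∧
      ∃ d : Q → ℕ, ∀ q ∉ MulAction.orbit H q₀, ∃ p, d p < d q ∧ ∃ i,
        (q = e i • p ∧ t q = e i * t p) ∨ (q = (e i)⁻¹ • p ∧ t q = (e i)⁻¹ * t p) := by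
  classical
  let B : ℕ → Set Q := fun n => Nat.rec (MulAction.orbit H q₀)
    (fun _ S => {q | ∃ p ∈ S, ∃ i, q = e i • p ∨ q = (e i)⁻¹ • p}) n
  have hex (q : Q) : ∃ n, q ∈ B n := by
    obtain ⟨f, rfl⟩ := MulAction.exists_smul_eq F q₀ q
    have hf : f ∈ Subgroup.closure (Set.range e) := hgen ▸ Subgroup.mem_top f
    induction hf using Subgroup.closure_induction_left with
    | one => exact ⟨0, by simp [B]⟩
    | mul_left x hx y _ ih =>
      obtain ⟨i, rfl⟩ := hx
      obtain ⟨n, hn⟩ := ih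
      exact ⟨n + 1, _, hn, i, Or.inl (mul_smul _ _ _)⟩
    | inv_mul_cancel x hx y _ ih =>
      obtain ⟨i, rfl⟩ := hx
      obtain ⟨n, hn⟩ := ih
      exact ⟨n + 1, _, hn, i, Or.inr (mul_smul _ _ _)⟩
  let d : Q → ℕ := fun q => sInf {n | q ∈ B n}
  have hpar (q : Q) (hq : q ∉ MulAction.orbit H q₀) :
      ∃ p, d p < d q ∧ ∃ s : F, q = s • p ∧ ∃ i, s = e i ∨ s = (e i)⁻¹ := by
    have hmem : q ∈ B (d q) := Nat.sInf_mem (hex q)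
    obtain ⟨n, hn⟩ : ∃ n, d q = n + 1 := by
      refine Nat.exists_eq_succ_of_ne_zero fun h0 => hq ?_
      rwa [h0] at hmem
    rw [hn] at hmem
    obtain ⟨p, hp, i, hi⟩ := hmem
    have hd : d p < d q := hn ▸ Nat.lt_succ_of_le (Nat.sInf_le hp)
    rcases hi with hi | hi
    · exact ⟨p, hd, _, hi, i, Or.inl rfl⟩
    · exact ⟨p, hd, _, hi, i, Or.inr rfl⟩
  choose! P hPd s hs hsi using hpar
  let T : Q → F := (measure d).wf.fix fun q ih =>
    if h : q ∈ MulAction.orbit H q₀ then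
      if q = q₀ then 1 else (h.choose : F)
    else s q * ih (P q) (hPd q h)
  have hT (q : Q) : T q = if h : q ∈ MulAction.orbit H q₀ then
      if q = q₀ then 1 else (h.choose : F) else s q * T (P q) :=
    (measure d).wf.fix_eq _ q
  have hT0 (q : Q) (h : q ∈ MulAction.orbit H q₀) : T q ∈ H ∧ T q • q₀ = q := by
    rw [hT, dif_pos h]
    split_ifs with hq
    · exact ⟨H.one_mem, by simp [hq]⟩
    · exact ⟨h.choose.2, h.choose_spec⟩
  have hT1 (q : Q) (h : q ∉ MulAction.orbit H q₀) : T q = s q * T (P q) := by rw [hT, dif_neg h]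
  refine ⟨T, ?_, fun q => ?_, fun q hq => (hT0 q hq).1, d, fun q hq => ⟨P q, hPd q hq, ?_⟩⟩
  · rw [hT, dif_pos (MulAction.mem_orbit_self q₀), if_pos rfl]
  · induction q using (measure d).wf.induction with
    | _ q ih =>
      by_cases hq : q ∈ MulAction.orbit H q₀
      · exact (hT0 q hq).2
      · rw [hT1 q hq, mul_smul, ih (P q) (hPd q hq), ← hs q hq]
  · obtain ⟨i, hi | hi⟩ := hsi q hq
    · exact ⟨i, Or.inl ⟨hi ▸ hs q hq, hi ▸ hT1 q hq⟩⟩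
    · exact ⟨i, Or.inr ⟨hi ▸ hs q hq, hi ▸ hT1 q hq⟩⟩

/-- If `F` is free on `e` and `H` is generated by part of the basis, then `H ∩ K` is a free factor of
every subgroup `K`. -/
theorem exists_internalFreeProduct_subgroupOf {F : Type u} [Group F] {ι : Type*} {e : ι → F}
    (hgen : Subgroup.closure (Set.range e) = ⊤)
    (hlift : ∀ {P : Type u} [Group P] (f : ι → P), ∃ φ : F →* P, ∀ i, φ (e i) = f i)
    (S : Set ι) {H : Subgroup F} (hH : Subgroup.closure (e '' S) = H) (K : Subgroup F) :
    ∃ L : Subgroup K, InternalFreeProduct (H.subgroupOf K) L := by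
  classical
  let q₀ : F ⧸ K := ((1 : F) : F ⧸ K)
  have hstab (f : F) : f • q₀ = q₀ ↔ f ∈ K := by
    rw [← MulAction.mem_stabilizer_iff]
    exact SetLike.ext_iff.1 (MulAction.stabilizer_quotient K) f
  obtain ⟨t, ht1, ht, htH, d, hd⟩ := exists_transversal hgen H q₀
  let loop (f : F) (q : F ⧸ K) : K := ⟨(t (f • q))⁻¹ * f * t q, by
    rw [← hstab, mul_smul, mul_smul, ht, inv_smul_eq_iff, ht]⟩
  have loop_mul (f g : F) (q : F ⧸ K) : loop (f * g) q = loop f (g • q) * loop g q := by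
    ext; simp [loop, mul_smul, mul_assoc]
  have loop_inv (f : F) (q : F ⧸ K) : loop f⁻¹ q = (loop f (f⁻¹ • q))⁻¹ := by
    ext; simp [loop, mul_assoc]
  have loop_mem (k : K) : loop k q₀ = k := by
    ext; simp [loop, (hstab k).2 k.2, ht1]
  have smul_orbit {h : F} (hh : h ∈ H) {q : F ⧸ K} (hq : q ∈ MulAction.orbit H q₀) :
      h • q ∈ MulAction.orbit H q₀ := MulAction.mem_orbit_of_mem_orbit (⟨h, hh⟩ : H) hq
  have loop_H {h : F} (hh : h ∈ H) {q : F ⧸ K} (hq : q ∈ MulAction.orbit H q₀) :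
      loop h q ∈ H.subgroupOf K := by
    rw [Subgroup.mem_subgroupOf]
    exact H.mul_mem (H.mul_mem (H.inv_mem (htH _ (smul_orbit hh hq))) hh) (htH _ hq)
  have he {i : ι} (hi : i ∈ S) : e i ∈ H := hH ▸ Subgroup.subset_closure ⟨i, hi, rfl⟩
  let L : Subgroup K := Subgroup.closure
    {k | ∃ i q, ¬(i ∈ S ∧ q ∈ MulAction.orbit H q₀) ∧ k = loop (e i) q}
  have loop_L {i : ι} {q : F ⧸ K} (h : ¬(i ∈ S ∧ q ∈ MulAction.orbit H q₀)) :
      loop (e i) q ∈ L := Subgroup.subset_closure ⟨i, q, h, rfl⟩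
  let N := Monoid.Coprod (H.subgroupOf K) L
  let Φ (i : ι) (q : F ⧸ K) : N :=
    if h : i ∈ S ∧ q ∈ MulAction.orbit H q₀ then
      Monoid.Coprod.inl ⟨loop (e i) q, loop_H (he h.1) h.2⟩
    else Monoid.Coprod.inr ⟨loop (e i) q, loop_L h⟩
  have Φ_one {i : ι} {q : F ⧸ K} (h : loop (e i) q = 1) : Φ i q = 1 := by
    simp only [Φ]
    split_ifs
    · exact (congrArg _ (Subtype.ext h)).trans (map_one Monoid.Coprod.inl)
    · exact (congrArg _ (Subtype.ext h)).trans (map_one Monoid.Coprod.inr)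
  obtain ⟨Ψ, Ψ_mul, hΨ⟩ := exists_cocycle hgen hlift Φ
  have Ψ_one (q : F ⧸ K) : Ψ 1 q = 1 := by simpa using Ψ_mul 1 1 q
  have Ψ_inv (f : F) (q : F ⧸ K) : Ψ f⁻¹ q = (Ψ f (f⁻¹ • q))⁻¹ := by
    rw [eq_inv_iff_mul_eq_one, ← Ψ_one (f⁻¹ • q), ← inv_mul_cancel f, Ψ_mul, smul_inv_smul]
  have Ψ_H {h : F} (hh : h ∈ H) : ∀ q (hq : q ∈ MulAction.orbit H q₀),
      Ψ h q = Monoid.Coprod.inl ⟨loop h q, loop_H hh hq⟩ := by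
    have hh' : h ∈ Subgroup.closure (e '' S) := hH ▸ hh
    induction hh' using Subgroup.closure_induction with
    | mem x hx =>
      obtain ⟨i, hi, rfl⟩ := hx
      intro q hq
      rw [hΨ]
      exact dif_pos ⟨hi, hq⟩
    | one =>
      intro q hq
      rw [Ψ_one, ← map_one Monoid.Coprod.inl]
      congr 1
      ext
      simp [loop]
    | mul x y hx hy ihx ihy =>
      rw [hH] at hx hy
      intro q hq
      rw [Ψ_mul, ihx hx _ (smul_orbit hy hq), ihy hy _ hq, ← map_mul]
      congr 1
      exact Subtype.ext (loop_mul x y q).symm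
    | inv x hx ih =>
      rw [hH] at hx
      intro q hq
      rw [Ψ_inv, ih hx _ (smul_orbit (H.inv_mem hx) hq), ← map_inv]
      congr 1
      exact Subtype.ext (loop_inv x q).symm
  have Ψ_t (q : F ⧸ K) : Ψ (t q) q₀ = 1 := by
    induction q using (measure d).wf.induction with
    | _ q ih =>
      by_cases hq : q ∈ MulAction.orbit H q₀
      · rw [Ψ_H (htH q hq) q₀ (MulAction.mem_orbit_self q₀), ← map_one Monoid.Coprod.inl]
        congr 1
        ext
        simp [loop, ht, ht1]
      · obtain ⟨p, hp, i, ⟨hqp, htq⟩ | ⟨hqp, htq⟩⟩ := hd q hq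
        · rw [htq, Ψ_mul, ih p hp, mul_one, ht, hΨ]
          apply Φ_one
          ext
          simp [loop, ← hqp, htq]
        · rw [htq, Ψ_mul, ih p hp, mul_one, ht, Ψ_inv, hΨ, inv_eq_one]
          apply Φ_one
          ext
          simp [loop, ← hqp, htq, hqp ▸ smul_inv_smul (e i) p]
  let ψ : K →* N :=
    { toFun := fun k => Ψ k q₀
      map_one' := Ψ_one q₀
      map_mul' := fun k l => by rw [Subgroup.coe_mul, Ψ_mul, (hstab l).2 l.2] }
  have ψ_loop (f : F) (q : F ⧸ K) : ψ (loop f q) = Ψ f q := by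
    change Ψ ((t (f • q))⁻¹ * f * t q) q₀ = _
    rw [Ψ_mul, Ψ_mul, Ψ_t, ht, mul_one, Ψ_inv, ← ht (f • q), ht, inv_smul_eq_iff.2 (ht _).symm,
      Ψ_t, inv_one, one_mul]
  refine ⟨L, ?_, ?_⟩
  · have hcomp : ψ.comp (Monoid.Coprod.lift (H.subgroupOf K).subtype L.subtype) =
        MonoidHom.id _ := by
      refine Monoid.Coprod.hom_ext ?_ ?_
      · ext m
        have hm : ((m : K) : F) ∈ H := m.2
        simp only [MonoidHom.comp_apply, Monoid.Coprod.lift_apply_inl, Subgroup.subtype_apply,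
          MonoidHom.id_apply]
        refine (Ψ_H hm q₀ (MulAction.mem_orbit_self q₀)).trans (congrArg _ ?_)
        exact Subtype.ext (loop_mem m)
      · have hL (l : K) (hl : l ∈ L) : ψ l = Monoid.Coprod.inr ⟨l, hl⟩ := by
          induction hl using Subgroup.closure_induction with
          | mem x hx =>
            obtain ⟨i, q, h, rfl⟩ := hx
            rw [ψ_loop, hΨ]
            exact dif_neg h
          | one => rw [map_one, ← map_one Monoid.Coprod.inr]; rfl
          | mul x y _ _ hx hy => rw [map_mul, hx, hy, ← map_mul]; rfl
          | inv x _ hx => rw [map_inv, hx, ← map_inv]; rfl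
        ext l
        simpa using hL l l.2
    exact Function.LeftInverse.injective (g := ψ) (DFunLike.congr_fun hcomp)
  · rw [← MonoidHom.range_eq_top, Monoid.Coprod.range_lift, Subgroup.range_subtype,
      Subgroup.range_subtype, eq_top_iff]
    have hloop (f : F) : ∀ q, loop f q ∈ H.subgroupOf K ⊔ L := by
      have hf : f ∈ Subgroup.closure (Set.range e) := hgen ▸ Subgroup.mem_top f
      induction hf using Subgroup.closure_induction with
      | mem x hx =>
        obtain ⟨i, rfl⟩ := hx
        intro q
        by_cases h : i ∈ S ∧ q ∈ MulAction.orbit H q₀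
        · exact Subgroup.mem_sup_left (loop_H (he h.1) h.2)
        · exact Subgroup.mem_sup_right (loop_L h)
      | one =>
        intro q
        have h1 : loop 1 q = 1 := by ext; simp [loop]
        exact h1 ▸ one_mem _
      | mul x y _ _ hx hy => exact fun q => loop_mul x y q ▸ mul_mem (hx _) (hy _)
      | inv x _ hx => exact fun q => loop_inv x q ▸ inv_mem (hx _)
    intro k _
    exact loop_mem k ▸ hloop k q₀

/-- A free factor of a free group meets every subgroup in a free factor of that subgroup. -/
theorem InternalFreeProduct.exists_subgroupOf {F : Type u} [Group F] [IsFreeGroup F]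
    {H H' : Subgroup F} (h : InternalFreeProduct H H') (K : Subgroup F) :
    ∃ L : Subgroup K, InternalFreeProduct (H.subgroupOf K) L := by
  let e : IsFreeGroup.Generators H ⊕ IsFreeGroup.Generators H' → F :=
    Sum.elim (fun i => (IsFreeGroup.of i : H)) fun i => (IsFreeGroup.of i : H')
  have hcl (J : Subgroup F) :
      Subgroup.closure (Set.range fun i => ((IsFreeGroup.of i : J) : F)) = J := by
    have : Subgroup.closure (Set.range (IsFreeGroup.of : _ → J)) = ⊤ := by
      have h1 : (IsFreeGroup.of : _ → J) =
          (IsFreeGroup.mulEquiv J).toMonoidHom ∘ FreeGroup.of := by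
        ext i
        simp [IsFreeGroup.of]
      rw [h1, Set.range_comp, ← MonoidHom.map_closure, FreeGroup.closure_range_of,
        ← MonoidHom.range_eq_map]
      exact MonoidHom.range_eq_top.2 (IsFreeGroup.mulEquiv J).surjective
    have h2 := congrArg (Subgroup.map J.subtype) this
    rwa [MonoidHom.map_closure, ← Set.range_comp, ← MonoidHom.range_eq_map,
      Subgroup.range_subtype] at h2
  refine exists_internalFreeProduct_subgroupOf (e := e) ?_ (fun {P} _ f => ?_)
    (Set.range Sum.inl) ?_ K
  · rw [Set.Sum.elim_range, Subgroup.closure_union, hcl, hcl, h.sup_eq_top]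
  · obtain ⟨φ, hφ, hφ'⟩ := h.exists_lift (IsFreeGroup.lift fun i => f (Sum.inl i))
      (IsFreeGroup.lift fun i => f (Sum.inr i))
    refine ⟨φ, ?_⟩
    rintro (i | i)
    · exact (hφ _).trans (IsFreeGroup.lift_of _ _)
    · exact (hφ' _).trans (IsFreeGroup.lift_of _ _)
  · rw [← Set.range_comp]
    exact hcl H

theorem InternalFreeProduct.map_mulEquiv {G : Type*} [Group G] {H K : Subgroup G}
    (h : InternalFreeProduct H K) (f : G ≃* G) :
    InternalFreeProduct (H.map f.toMonoidHom) (K.map f.toMonoidHom) := by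
  have e : (Monoid.Coprod.lift (H.map f.toMonoidHom).subtype (K.map f.toMonoidHom).subtype).comp
      (MulEquiv.coprodCongr (f.subgroupMap H) (f.subgroupMap K)).toMonoidHom =
      f.toMonoidHom.comp (Monoid.Coprod.lift H.subtype K.subtype) := by
    refine Monoid.Coprod.hom_ext ?_ ?_ <;> ext x
    · exact (Monoid.Coprod.lift_apply_inl (H.map f.toMonoidHom).subtype
        (K.map f.toMonoidHom).subtype (f.subgroupMap H x)).trans
        (congrArg f (Monoid.Coprod.lift_apply_inl H.subtype K.subtype x)).symm
    · exact (Monoid.Coprod.lift_apply_inr (H.map f.toMonoidHom).subtype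
        (K.map f.toMonoidHom).subtype (f.subgroupMap K x)).trans
        (congrArg f (Monoid.Coprod.lift_apply_inr H.subtype K.subtype x)).symm
  have hb : Function.Bijective ((Monoid.Coprod.lift (H.map f.toMonoidHom).subtype
      (K.map f.toMonoidHom).subtype).comp
      (MulEquiv.coprodCongr (f.subgroupMap H) (f.subgroupMap K)).toMonoidHom) := by
    rw [e]
    exact f.bijective.comp h
  exact (Function.Bijective.of_comp_iff _ (MulEquiv.bijective _)).1 hb

/-- If `F₁` is a freely `A`-indecomposable free factor containing `A ≠ 1`, it is contained in all
its images under automorphisms fixing `A`. -/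
theorem InternalFreeProduct.le_map_of_fixes {F : Type u} [Group F] [IsFreeGroup F]
    {A F₁ F₂ : Subgroup F} (hA : A ≠ ⊥) (h : InternalFreeProduct F₁ F₂) (hAF₁ : A ≤ F₁)
    (hindec : FreelyIndecomposableRel (A.subgroupOf F₁)) (f : F ≃* F) (hf : ∀ a ∈ A, f a = a) :
    F₁ ≤ F₁.map f.toMonoidHom := by
  obtain ⟨L, hL⟩ := (h.map_mulEquiv f).exists_subgroupOf F₁
  have hAf : A ≤ F₁.map f.toMonoidHom := fun a ha => ⟨a, hAF₁ ha, hf a ha⟩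
  have hLbot : L = ⊥ := by
    by_contra hne
    refine hindec ⟨_, L, fun hbot => hA ?_, hne, fun a ha => hAf ha, hL⟩
    rw [eq_bot_iff]
    intro a ha
    have : (⟨a, hAF₁ ha⟩ : F₁) ∈ (F₁.map f.toMonoidHom).subgroupOf F₁ := hAf ha
    rw [hbot, Subgroup.mem_bot] at this
    exact congrArg Subtype.val this
  have htop := hL.sup_eq_top
  rwa [hLbot, sup_bot_eq, Subgroup.subgroupOf_eq_top] at htop

end FreeFactor

/-- The restricted algebraic closure of a subset of a nontrivial free factor of a torsion-free group
is contained in that factor. -/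
theorem InternalFreeProduct.racl_subset {G : Type*} [Group G] [IsMulTorsionFree G]
    {H K : Subgroup G} (h : InternalFreeProduct H K) {A : Set G} (hAH : A ⊆ H) (hH : H ≠ ⊥) :
    racl A ⊆ H := by
  intro g hg
  by_contra hgH
  obtain ⟨a, haH, ha⟩ := H.bot_or_exists_ne_one.resolve_left hH
  choose f hf hf' using fun n : ℕ => h.exists_mulEquiv (MulEquiv.refl H)
    (⟨a ^ n, H.pow_mem haH n⟩ : H)
  replace hf (n : ℕ) (x : G) (hx : x ∈ H) : f n x = x := hf n ⟨x, hx⟩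
  have hfs (n : ℕ) (x : G) (hx : x ∈ H) : (f n).symm x = x := by
    rw [MulEquiv.symm_apply_eq, hf n x hx]
  have hmem (n : ℕ) : f n g ∈ {x : G | ∃ f : G ≃* G, (∀ a ∈ A, f a = a) ∧ f g = x} :=
    ⟨f n, fun x hx => hf n x (hAH hx), rfl⟩
  refine Set.infinite_of_injective_forall_mem (fun n m hnm => ?_) hmem hg
  by_contra hne
  have han (k : ℕ) : a ^ k ∈ H := H.pow_mem haH k
  refine hgH (h.mem_of_apply_eq (b := a ^ m * (a ^ n)⁻¹)
    (H.mul_mem (han m) (H.inv_mem (han n))) (fun h1 => ?_)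
    (f := (f n).symm.toMonoidHom.comp (f m).toMonoidHom) (fun x hx => ?_) (fun y hy => ?_) ?_)
  · exact hne (injective_pow_iff_not_isOfFinOrder.2
      (not_isOfFinOrder_of_isMulTorsionFree ha) (mul_inv_eq_one.1 h1)).symm
  · simp [hf m x hx, hfs n x hx]
  · have hy' : (f n).symm y = (a ^ n)⁻¹ * y * a ^ n := by
      rw [MulEquiv.symm_apply_eq, map_mul, map_mul, hf' n y hy, map_inv, hf n _ (han n)]
      simp [mul_assoc]
    change (f n).symm (f m y) = _
    rw [hf' m y hy, map_mul, map_mul, map_inv, hy', hfs n _ (han m)]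
    simp [mul_assoc]
  · change (f n).symm (f m g) = g
    rw [MulEquiv.symm_apply_eq]
    exact hnm.symm

/-- Let `F` be a free group of finite rank and `A` a nonabelian
subgroup. Suppose `F = F₁ ∗ F₂` is an internal free product decomposition with `A ≤ F₁`
and `F₁` freely `A`-indecomposable. Then `racl_F(A) = racl_{F₁}(A)`. -/
theorem racl_eq_racl_of_freeProduct {F : Type*} [Group F] (hF : IsFreeOfFiniteRank F)
    (A : Subgroup F) (hA : Nonabelian (A : Set F))
    (F₁ F₂ : Subgroup F) (hfp : InternalFreeProduct F₁ F₂) (hAF₁ : A ≤ F₁)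
    (hindec : FreelyIndecomposableRel (A.subgroupOf F₁)) :
    racl (A : Set F) =
      Subtype.val '' racl ((A.subgroupOf F₁ : Subgroup ↥F₁) : Set ↥F₁) := by
  obtain ⟨n, ⟨e⟩⟩ := hF
  have : IsFreeGroup F := IsFreeGroup.ofMulEquiv e.symm
  have : IsMulTorsionFree F := e.injective.isMulTorsionFree e.toMonoidHom
  have hAbot : A ≠ ⊥ := by
    rintro rfl
    obtain ⟨x, hx, y, hy, hxy⟩ := hA
    rw [SetLike.mem_coe, Subgroup.mem_bot] at hx hy
    exact hxy (by rw [hx, hy])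
  apply Set.Subset.antisymm
  · intro g hg
    have hg₁ : g ∈ F₁ := hfp.racl_subset hAF₁ (fun h => hAbot (le_bot_iff.1 (h ▸ hAF₁))) hg
    refine ⟨⟨g, hg₁⟩, ?_, rfl⟩
    refine (Set.Finite.preimage Subtype.val_injective.injOn hg).subset ?_
    rintro x ⟨α, hα, rfl⟩
    obtain ⟨f, hf, -⟩ := hfp.exists_mulEquiv α 1
    exact ⟨f, fun a ha => (hf ⟨a, hAF₁ ha⟩).trans (congrArg Subtype.val (hα ⟨a, hAF₁ ha⟩ ha)),
      hf ⟨g, hg₁⟩⟩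
  · rintro _ ⟨g, hg, rfl⟩
    refine (Set.Finite.image Subtype.val hg).subset ?_
    rintro x ⟨f, hf, rfl⟩
    have hf' : ∀ a ∈ A, f.symm a = a := fun a ha => by rw [MulEquiv.symm_apply_eq, hf a ha]
    have hmap : F₁.map f.toMonoidHom = F₁ := by
      apply le_antisymm
      · rintro _ ⟨x, hx, rfl⟩
        obtain ⟨y, hy, rfl⟩ := hfp.le_map_of_fixes hAbot hAF₁ hindec f.symm hf' hx
        simpa using hy
      · exact hfp.le_map_of_fixes hAbot hAF₁ hindec f hf
    refine ⟨_, ⟨(f.subgroupMap F₁).trans (MulEquiv.subgroupCongr hmap), fun a ha => ?_, rfl⟩, rfl⟩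
    exact Subtype.ext (hf a ha)
end
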